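/- Let G be a finite connected unicyclic graph on n vertices whose unique cycle has length l ≥ 3 and whose maximum degree is Δ ≥ 3, and assume n ≥ l + Δ − 2. Then Kf(G) ≤ (n−Δ+1)(n−Δ+2)(n+2Δ−9)/6 + (Δ−3)(Δ−2/3) + (n−Δ)² + 7(n−Δ)/3 + 2, with equality if and only if G is isomorphic to P_{n,Δ}^3. -/

import Mathlib

open scoped Classical

noncomputable section

namespace KfPaper

variable {V : Type*} {W : Type*}

/-- The energy of a potential `f` on graph `G`, viewing each edge as a unit resistor:
`(1/2) · ∑_{x,y adjacent} (f x - f y)²` (each edge counted twice, hence the `1/2`). -/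
def energy [Fintype V] (G : SimpleGraph V) (f : V → ℝ) : ℝ :=
  (1 / 2) * ∑ x : V, ∑ y : V, (if G.Adj x y then (f x - f y) ^ 2 else 0)

/-- The resistance distance (effective resistance) between `u` and `v`:
`r(u,v) = 1 / inf { energy f : f u = 1, f v = 0 }` and `r(u,u) = 0`. -/
def resistanceDistance [Fintype V] (G : SimpleGraph V) (u v : V) : ℝ :=
  if u = v then 0
  else 1 / sInf {e : ℝ | ∃ f : V → ℝ, f u = 1 ∧ f v = 0 ∧ energy G f = e}

/-- The Kirchhoff index: sum of resistance distances over unordered pairs of distinct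
vertices (each ordered pair counted once via the factor `1/2`, diagonal terms vanish). -/
def kirchhoffIndex [Fintype V] (G : SimpleGraph V) : ℝ :=
  (1 / 2) * ∑ u : V, ∑ v : V, resistanceDistance G u v

/-- `Kf_v(G) = ∑_{u ≠ v} r(v,u)` (the term `u = v` contributes `0`). -/
def kirchhoffAt [Fintype V] (G : SimpleGraph V) (v : V) : ℝ :=
  ∑ u : V, resistanceDistance G v u

/-- The Wiener index: sum of graph distances over unordered pairs of distinct vertices. -/
def wienerIndex [Fintype V] (G : SimpleGraph V) : ℝ :=
  (1 / 2) * ∑ u : V, ∑ v : V, (G.dist u v : ℝ)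

/-- `W_v(G) = ∑_u d(v,u)`. -/
def wienerAt [Fintype V] (G : SimpleGraph V) (v : V) : ℝ :=
  ∑ u : V, (G.dist v u : ℝ)

/-- The degree of a vertex. -/
def degree' (G : SimpleGraph V) (v : V) : ℕ := Nat.card (G.neighborSet v)

/-- `G` has maximum degree `Δ`. -/
def HasMaxDegree (G : SimpleGraph V) (Δ : ℕ) : Prop :=
  (∀ v, degree' G v ≤ Δ) ∧ ∃ v, degree' G v = Δ

/-- A unicyclic graph: a connected graph containing exactly one cycle, equivalently a
connected graph with as many edges as vertices. -/
def IsUnicyclic [Fintype V] (G : SimpleGraph V) : Prop :=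
  G.Connected ∧ Nat.card G.edgeSet = Fintype.card V

/-- `P_{n,Δ}^3`: the unicyclic graph on `Fin n` with a triangle on `0,1,2`, with `Δ−3`
pendant vertices `3,…,Δ−1` attached to the triangle vertex `2`, and one end-vertex of the
path `Δ, Δ+1, …, n−1` (on `n−Δ` vertices) attached to `2` (so `2` has degree `Δ`). -/
def PnD3 (n Δ : ℕ) : SimpleGraph (Fin n) :=
  SimpleGraph.fromRel (fun i j =>
    (i.val = 0 ∧ j.val = 1) ∨ (i.val = 0 ∧ j.val = 2) ∨ (i.val = 1 ∧ j.val = 2) ∨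
    (i.val = 2 ∧ 3 ≤ j.val ∧ j.val ≤ Δ) ∨
    (Δ ≤ i.val ∧ j.val = i.val + 1))

section Resistance

variable [Fintype V]

lemma energy_nonneg (G : SimpleGraph V) (f : V → ℝ) : 0 ≤ energy G f := by
  unfold energy
  have : 0 ≤ ∑ x : V, ∑ y : V, (if G.Adj x y then (f x - f y) ^ 2 else 0) :=
    Finset.sum_nonneg fun x _ => Finset.sum_nonneg fun y _ => by split_ifs <;> positivity
  linarith

/-- The energy dominates the contribution of any family of distinct edges. -/
lemma sum_sq_le_energy {ι : Type*} (G : SimpleGraph V) (f : V → ℝ) (s : Finset ι) (a b : ι → V)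
    (hadj : ∀ i ∈ s, G.Adj (a i) (b i))
    (hinj : ∀ i ∈ s, ∀ j ∈ s, s(a i, b i) = s(a j, b j) → i = j) :
    ∑ i ∈ s, (f (a i) - f (b i)) ^ 2 ≤ energy G f := by
  set F : V × V → ℝ := fun q => if G.Adj q.1 q.2 then (f q.1 - f q.2) ^ 2 else 0 with hF
  have hF0 : ∀ q, 0 ≤ F q := fun q => by simp only [hF]; split_ifs <;> positivity
  have h1 : ∑ q ∈ s.image (fun i => (a i, b i)), F q = ∑ i ∈ s, (f (a i) - f (b i)) ^ 2 := by
    rw [Finset.sum_image]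
    · exact Finset.sum_congr rfl fun i hi => by simp [hF, hadj i hi]
    · intro i hi j hj h
      simp only [Prod.mk.injEq] at h
      exact hinj i hi j hj (by rw [h.1, h.2])
  have h2 : ∑ q ∈ s.image (fun i => (b i, a i)), F q = ∑ i ∈ s, (f (a i) - f (b i)) ^ 2 := by
    rw [Finset.sum_image]
    · refine Finset.sum_congr rfl fun i hi => ?_
      simp only [hF, (hadj i hi).symm, if_true]
      ring
    · intro i hi j hj h
      simp only [Prod.mk.injEq] at h
      exact hinj i hi j hj (by rw [h.1, h.2])
  have hdisj : Disjoint (s.image (fun i => (a i, b i))) (s.image (fun i => (b i, a i))) := by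
    rw [Finset.disjoint_left]
    simp only [Finset.mem_image, not_exists, not_and]
    rintro q ⟨i, hi, rfl⟩ j hj h
    simp only [Prod.mk.injEq] at h
    have := hinj i hi j hj (by rw [← h.1, ← h.2, Sym2.eq_swap])
    subst this
    exact (hadj i hi).ne h.1.symm
  have h3 : ∑ q ∈ s.image (fun i => (a i, b i)) ∪ s.image (fun i => (b i, a i)), F q
      ≤ ∑ q : V × V, F q :=
    Finset.sum_le_sum_of_subset_of_nonneg (Finset.subset_univ _) fun q _ _ => hF0 q
  rw [Finset.sum_union hdisj, h1, h2, Fintype.sum_prod_type] at h3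
  unfold energy
  linarith

lemma energy_comp_affine (G : SimpleGraph V) (f : V → ℝ) (c t : ℝ) :
    energy G (fun x => c * (f x - t)) = c ^ 2 * energy G f := by
  unfold energy
  simp_rw [Finset.mul_sum]
  refine Finset.sum_congr rfl fun x _ => Finset.sum_congr rfl fun y _ => ?_
  split_ifs <;> ring

lemma resistanceDistance_nonneg (G : SimpleGraph V) (u v : V) : 0 ≤ resistanceDistance G u v := by
  unfold resistanceDistance
  split_ifs
  · exact le_rfl
  · refine div_nonneg zero_le_one (Real.sInf_nonneg ?_)
    rintro e ⟨f, -, -, rfl⟩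
    exact energy_nonneg G f

/-- An upper bound for the resistance, in terms of all potentials. -/
lemma resistanceDistance_le {G : SimpleGraph V} {u v : V} {R : ℝ} (hR : 0 ≤ R)
    (h : ∀ f : V → ℝ, (f u - f v) ^ 2 ≤ R * energy G f) : resistanceDistance G u v ≤ R := by
  unfold resistanceDistance
  split_ifs with huv
  · exact hR
  have hne : {e : ℝ | ∃ f : V → ℝ, f u = 1 ∧ f v = 0 ∧ energy G f = e}.Nonempty :=
    ⟨_, fun x => if x = u then 1 else 0, by simp, by simp [Ne.symm huv], rfl⟩
  have hRpos : 0 < R := by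
    rcases hR.lt_or_eq with h0 | h0
    · exact h0
    · have := h (fun x => if x = u then 1 else 0)
      simp [Ne.symm huv, ← h0] at this
      linarith
  have hle : 1 / R ≤ sInf {e : ℝ | ∃ f : V → ℝ, f u = 1 ∧ f v = 0 ∧ energy G f = e} := by
    refine le_csInf hne ?_
    rintro e ⟨f, hu, hv, rfl⟩
    have := h f
    rw [hu, hv] at this
    rw [div_le_iff₀ hRpos]
    linarith
  have := one_div_le_one_div_of_le (one_div_pos.2 hRpos) hle
  simpa using this

lemma exists_sq_le_of_reachable {G : SimpleGraph V} {u v : V} (h : G.Reachable u v) :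
    ∃ R : ℝ, 0 < R ∧ ∀ f : V → ℝ, (f u - f v) ^ 2 ≤ R * energy G f := by
  obtain ⟨w⟩ := h
  induction w with
  | nil => exact ⟨1, one_pos, fun f => by simpa using energy_nonneg G f⟩
  | @cons x y z hxy _ ih =>
    obtain ⟨R, hR, h⟩ := ih
    refine ⟨2 + 2 * R, by positivity, fun f => ?_⟩
    have h1 := sum_sq_le_energy G f ({()} : Finset Unit) (fun _ => x) (fun _ => y)
      (by simpa using hxy) (by simp)
    simp only [Finset.sum_const, Finset.card_singleton, one_smul] at h1
    nlinarith [h f, sq_nonneg ((f x - f y) - (f y - f z))]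

/-- The defining variational inequality of the resistance distance. -/
lemma sq_le_resistanceDistance_mul_energy {G : SimpleGraph V} {u v : V} (h : G.Reachable u v)
    (f : V → ℝ) : (f u - f v) ^ 2 ≤ resistanceDistance G u v * energy G f := by
  by_cases huv : u = v
  · subst huv
    simp [resistanceDistance]
  obtain ⟨R, hR, hRf⟩ := exists_sq_le_of_reachable h
  unfold resistanceDistance
  rw [if_neg huv]
  set S := {e : ℝ | ∃ f : V → ℝ, f u = 1 ∧ f v = 0 ∧ energy G f = e} with hS
  have hne : S.Nonempty :=
    ⟨_, fun x => if x = u then 1 else 0, by simp, by simp [Ne.symm huv], rfl⟩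
  have hpos : 0 < sInf S := by
    refine lt_of_lt_of_le (one_div_pos.2 hR) (le_csInf hne ?_)
    rintro e ⟨g, hu, hv, rfl⟩
    have := hRf g
    rw [hu, hv] at this
    rw [div_le_iff₀ hR]
    linarith
  by_cases hδ : f u - f v = 0
  · rw [hδ]
    rw [zero_pow two_ne_zero]
    exact mul_nonneg (one_div_pos.2 hpos).le (energy_nonneg G f)
  have hmem : ((f u - f v)⁻¹) ^ 2 * energy G f ∈ S :=
    ⟨fun x => (f u - f v)⁻¹ * (f x - f v), by field_simp, by simp,
      energy_comp_affine G f _ _⟩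
  have hle : sInf S ≤ ((f u - f v)⁻¹) ^ 2 * energy G f := by
    refine csInf_le ⟨0, ?_⟩ hmem
    rintro e ⟨g, -, -, rfl⟩
    exact energy_nonneg G g
  have hδ2 : 0 < (f u - f v) ^ 2 := by positivity
  rw [one_div, inv_mul_eq_div, le_div_iff₀ hpos]
  calc (f u - f v) ^ 2 * sInf S ≤ (f u - f v) ^ 2 * (((f u - f v)⁻¹) ^ 2 * energy G f) := by
        gcongr
    _ = energy G f := by field_simp

lemma resistanceDistance_self (G : SimpleGraph V) (u : V) : resistanceDistance G u u = 0 := by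
  simp [resistanceDistance]

lemma resistanceDistance_comm {G : SimpleGraph V} (hG : G.Connected) (u v : V) :
    resistanceDistance G u v = resistanceDistance G v u := by
  have key : ∀ a b, resistanceDistance G a b ≤ resistanceDistance G b a := fun a b =>
    resistanceDistance_le (resistanceDistance_nonneg G b a) fun f => by
      have := sq_le_resistanceDistance_mul_energy (hG b a) f
      linarith [sq_nonneg (f a - f b), show (f a - f b) ^ 2 = (f b - f a) ^ 2 by ring]
  exact le_antisymm (key u v) (key v u)

/-- Thomson's principle: a unit flow from `u` to `v` carried by distinct edges bounds the
resistance by its energy. -/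
lemma resistanceDistance_le_of_flow {ι : Type*} {G : SimpleGraph V} {u v : V} (s : Finset ι)
    (a b : ι → V) (c : ι → ℝ) (hadj : ∀ i ∈ s, G.Adj (a i) (b i))
    (hinj : ∀ i ∈ s, ∀ j ∈ s, s(a i, b i) = s(a j, b j) → i = j)
    (hflow : ∀ f : V → ℝ, f u - f v = ∑ i ∈ s, c i * (f (a i) - f (b i))) :
    resistanceDistance G u v ≤ ∑ i ∈ s, c i ^ 2 := by
  have h0 : 0 ≤ ∑ i ∈ s, c i ^ 2 := Finset.sum_nonneg fun i _ => sq_nonneg _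
  refine resistanceDistance_le h0 fun f => ?_
  rw [hflow f]
  exact (Finset.sum_mul_sq_le_sq_mul_sq s _ _).trans
    (mul_le_mul_of_nonneg_left (sum_sq_le_energy G f s a b hadj hinj) h0)

end Resistance

section Iso

variable [Fintype V] [Fintype W]

lemma energy_iso {G : SimpleGraph V} {H : SimpleGraph W} (e : G ≃g H) (f : W → ℝ) :
    energy G (f ∘ e) = energy H f := by
  unfold energy
  congr 1
  refine Fintype.sum_equiv e.toEquiv _ _ fun x => Fintype.sum_equiv e.toEquiv _ _ fun y => ?_
  simp [e.map_adj_iff]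

lemma kirchhoffIndex_le_of_iso {G : SimpleGraph V} {H : SimpleGraph W} (hG : G.Connected)
    (e : G ≃g H) : kirchhoffIndex H ≤ kirchhoffIndex G := by
  unfold kirchhoffIndex
  refine mul_le_mul_of_nonneg_left ?_ (by norm_num)
  rw [← Equiv.sum_comp e.toEquiv]
  refine Finset.sum_le_sum fun u _ => ?_
  rw [← Equiv.sum_comp e.toEquiv]
  refine Finset.sum_le_sum fun v _ => ?_
  refine resistanceDistance_le (resistanceDistance_nonneg G u v) fun f => ?_
  have := sq_le_resistanceDistance_mul_energy (hG u v) (f ∘ e)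
  rwa [energy_iso] at this

end Iso

section Layers

/-- `par` sends every vertex other than `p` to a neighbour that is closer to `p`. -/
structure IsParent (G : SimpleGraph V) (p : V) (par : V → V) : Prop where
  adj : ∀ v, v ≠ p → G.Adj v (par v)
  dist : ∀ v, v ≠ p → G.dist p (par v) + 1 = G.dist p v

lemma dist_le_succ_of_adj {G : SimpleGraph V} (hG : G.Connected) (p : V) {u v : V}
    (h : G.Adj u v) : G.dist p v ≤ G.dist p u + 1 := by
  have h1 := hG.dist_triangle (u := p) (v := u) (w := v)
  rw [SimpleGraph.dist_eq_one_iff_adj.2 h] at h1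
  exact h1

lemma exists_isParent {G : SimpleGraph V} (hG : G.Connected) (p : V) :
    ∃ par : V → V, IsParent G p par := by
  have key : ∀ v, ∃ u, v ≠ p → G.Adj v u ∧ G.dist p u + 1 = G.dist p v := by
    intro v
    by_cases hv : v = p
    · exact ⟨p, fun h => absurd hv h⟩
    obtain ⟨w, hw⟩ := (hG v p).exists_walk_length_eq_dist
    cases w with
    | nil => exact absurd rfl hv
    | @cons _ u _ h w =>
      refine ⟨u, fun _ => ⟨h, ?_⟩⟩
      have h1 := SimpleGraph.dist_le w
      have h2 := dist_le_succ_of_adj hG p h.symm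
      rw [SimpleGraph.Walk.length_cons, SimpleGraph.dist_comm] at hw
      rw [SimpleGraph.dist_comm] at h1
      omega
  choose par hpar using key
  exact ⟨par, fun v hv => (hpar v hv).1, fun v hv => (hpar v hv).2⟩

namespace IsParent

variable {G : SimpleGraph V} {p : V} {par : V → V}

lemma eq_of_edge_eq (h : IsParent G p par) {v w : V} (hv : v ≠ p) (hw : w ≠ p)
    (he : s(v, par v) = s(w, par w)) : v = w := by
  rw [Sym2.eq_iff] at he
  rcases he with he | ⟨h1, h2⟩
  · exact he.1
  · have := h.dist v hv
    have := h.dist w hw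
    rw [h2] at *
    rw [← h1] at *
    omega

lemma exists_dist_eq (h : IsParent G p par) (v : V) {j : ℕ} (hj : j ≤ G.dist p v) :
    ∃ u, G.dist p u = j := by
  induction hk : G.dist p v generalizing v with
  | zero => exact ⟨v, by omega⟩
  | succ k ih =>
    by_cases hjk : j = k + 1
    · exact ⟨v, by omega⟩
    · have hv : v ≠ p := by
        rintro rfl
        simp at hk
      have := h.dist v hv
      exact ih (par v) (by omega) (by omega)

/-- The vertices other than `p` on the path of successive parents from `v` to `p`. -/
lemma exists_ancestors (h : IsParent G p par) (v : V) :
    ∃ A : Finset V, A.card = G.dist p v ∧ (∀ u ∈ A, u ≠ p ∧ G.dist p u ≤ G.dist p v) ∧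
      (∀ u ∈ A, G.dist p u = G.dist p v → u = v) ∧ (v ≠ p → v ∈ A) ∧
      (v ≠ p → par v ≠ p → par v ∈ A) ∧
      ∀ f : V → ℝ, f v - f p = ∑ u ∈ A, (f u - f (par u)) := by
  induction hk : G.dist p v generalizing v with
  | zero =>
    by_cases hv : v = p
    · subst hv
      exact ⟨∅, by simp, by simp, by simp, by simp, by simp, by simp⟩
    · have := h.dist v hv
      omega
  | succ k ih =>
    have hv : v ≠ p := by
      rintro rfl
      simp at hk
    have hd := h.dist v hv
    obtain ⟨A, hc, hA, hA', hmem, -, hf⟩ := ih (par v) (by omega)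
    have hvA : v ∉ A := fun hvA => by
      have := (hA v hvA).2
      omega
    refine ⟨insert v A, ?_, ?_, ?_, fun _ => Finset.mem_insert_self _ _,
      fun _ hp => Finset.mem_insert_of_mem (hmem hp), fun f => ?_⟩
    · rw [Finset.card_insert_of_notMem hvA, hc]
    · intro u hu
      rcases Finset.mem_insert.1 hu with rfl | hu
      · exact ⟨hv, by omega⟩
      · exact ⟨(hA u hu).1, by have := (hA u hu).2; omega⟩
    · intro u hu hdu
      rcases Finset.mem_insert.1 hu with rfl | hu
      · rfl
      · have := (hA u hu).2
        omega
    · rw [Finset.sum_insert hvA, ← hf f]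
      ring

variable [Fintype V]

/-- Routing a fraction `α` of the flow from `a` to `p` through a non-tree edge `ab`. -/
lemma resistanceDistance_le_detour (h : IsParent G p par) {a b : V} (hab : G.Adj a b)
    (hne : ∀ v, v ≠ p → s(v, par v) ≠ s(a, b)) {A B : Finset V} (hA : ∀ u ∈ A, u ≠ p)
    (hB : ∀ u ∈ B, u ≠ p)
    (hfA : ∀ f : V → ℝ, f a - f p = ∑ u ∈ A, (f u - f (par u)))
    (hfB : ∀ f : V → ℝ, f b - f p = ∑ u ∈ B, (f u - f (par u))) (α : ℝ) :
    resistanceDistance G a p ≤ (A.card : ℝ) - 2 * α * (A \ B).card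
      + α ^ 2 * ((A \ B).card + (B \ A).card + 1) := by
  have hsum : ∀ (C : Finset V), (∀ u ∈ C, u ≠ p) → ∀ g : V → ℝ,
      ∑ u ∈ C, g u = ∑ u ∈ Finset.univ.erase p, if u ∈ C then g u else 0 := by
    intro C hC g
    rw [← Finset.sum_filter]
    refine Finset.sum_congr ?_ fun _ _ => rfl
    ext u
    simp only [Finset.mem_filter, Finset.mem_erase, Finset.mem_univ, and_true]
    exact ⟨fun hu => ⟨hC u hu, hu⟩, fun hu => hu.2⟩
  have hcard : ∀ (C : Finset V), (∀ u ∈ C, u ≠ p) →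
      (C.card : ℝ) = ∑ u ∈ Finset.univ.erase p, if u ∈ C then 1 else 0 := by
    intro C hC
    rw [← hsum C hC (fun _ => 1)]
    simp
  let c : Option V → ℝ := fun o => o.elim α fun u =>
    (if u ∈ A then 1 else 0) - α * ((if u ∈ A then 1 else 0) - (if u ∈ B then 1 else 0))
  have key := resistanceDistance_le_of_flow (G := G) (u := a) (v := p)
    (Finset.insertNone (Finset.univ.erase p)) (fun o => o.elim a id) (fun o => o.elim b par) c
    (by
      intro o ho
      cases o with
      | none => exact hab
      | some v => exact h.adj v (by simpa using ho))
    (by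
      intro o ho o' ho' he
      cases o with
      | none =>
        cases o' with
        | none => rfl
        | some w => exact absurd he.symm (hne w (by simpa using ho'))
      | some v =>
        cases o' with
        | none => exact absurd he (hne v (by simpa using ho))
        | some w => exact congrArg some (h.eq_of_edge_eq (by simpa using ho) (by simpa using ho') he))
    (by
      intro f
      rw [Finset.sum_insertNone]
      simp only [c, Option.elim_none, Option.elim_some, id_eq]
      have e1 := hfA f
      have e2 := hfB f
      rw [hsum A hA] at e1
      rw [hsum B hB] at e2
      have : ∀ u, ((if u ∈ A then 1 else 0) - α * ((if u ∈ A then 1 else 0)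
          - (if u ∈ B then 1 else 0))) * (f u - f (par u))
          = (1 - α) * (if u ∈ A then f u - f (par u) else 0)
            + α * (if u ∈ B then f u - f (par u) else 0) := by
        intro u
        split_ifs <;> ring
      simp_rw [this]
      rw [Finset.sum_add_distrib, ← Finset.mul_sum, ← Finset.mul_sum, ← e1, ← e2]
      ring)
  refine key.trans (le_of_eq ?_)
  rw [Finset.sum_insertNone, hcard A hA,
    hcard (A \ B) (fun u hu => hA u (Finset.mem_sdiff.1 hu).1),
    hcard (B \ A) (fun u hu => hB u (Finset.mem_sdiff.1 hu).1)]
  simp only [c, Option.elim_none, Option.elim_some, mul_add, Finset.mul_sum]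
  have : ∀ u, ((if u ∈ A then (1 : ℝ) else 0) - α * ((if u ∈ A then 1 else 0)
      - (if u ∈ B then 1 else 0))) ^ 2
      = (if u ∈ A then 1 else 0) - 2 * α * (if u ∈ A \ B then 1 else 0)
        + α ^ 2 * (if u ∈ A \ B then 1 else 0) + α ^ 2 * (if u ∈ B \ A then 1 else 0) := by
    intro u
    by_cases h1 : u ∈ A <;> by_cases h2 : u ∈ B <;> (simp [h1, h2]; try ring)
  simp_rw [this, Finset.sum_add_distrib, Finset.sum_sub_distrib]
  ring

lemma resistanceDistance_le_dist (hG : G.Connected) (u v : V) :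
    resistanceDistance G u v ≤ G.dist u v := by
  obtain ⟨par, h⟩ := exists_isParent hG v
  obtain ⟨A, hc, hA, -, -, -, hf⟩ := h.exists_ancestors u
  have := resistanceDistance_le_of_flow (G := G) (u := u) (v := v) A id par (fun _ => 1)
    (fun w hw => h.adj w (hA w hw).1)
    (fun w hw w' hw' he => h.eq_of_edge_eq (hA w hw).1 (hA w' hw').1 he)
    (fun f => by simpa using hf f)
  simpa [hc, SimpleGraph.dist_comm] using this

lemma card_edges_image (h : IsParent G p par) :
    ((Finset.univ.erase p).image fun v => s(v, par v)).card = Fintype.card V - 1 := by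
  rw [Finset.card_image_of_injOn, Finset.card_erase_of_mem (Finset.mem_univ _), Finset.card_univ]
  intro v hv w hw he
  exact h.eq_of_edge_eq (by simpa using hv) (by simpa using hw) he

/-- A unicyclic graph has exactly one edge outside of a tree of parents. -/
lemma exists_extra_edge (h : IsParent G p par) (hE : G.edgeFinset.card = Fintype.card V) :
    ∃ a b, G.Adj a b ∧ G.dist p b ≤ G.dist p a ∧ (∀ v, v ≠ p → s(v, par v) ≠ s(a, b)) ∧
      ∀ u v, G.Adj u v → (u ≠ p ∧ v = par u) ∨ (v ≠ p ∧ u = par v) ∨ s(u, v) = s(a, b) := by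
  set T := (Finset.univ.erase p).image fun v => s(v, par v) with hT
  have hsub : T ⊆ G.edgeFinset := by
    intro e he
    obtain ⟨v, hv, rfl⟩ := Finset.mem_image.1 he
    simpa using h.adj v (by simpa using hv)
  have hpos : 0 < Fintype.card V := Fintype.card_pos_iff.2 ⟨p⟩
  have hone : (G.edgeFinset \ T).card = 1 := by
    rw [Finset.card_sdiff_of_subset hsub, h.card_edges_image, hE]
    omega
  obtain ⟨e, he⟩ := Finset.card_eq_one.1 hone
  have main : ∀ a b, e = s(a, b) → G.Adj a b ∧ (∀ v, v ≠ p → s(v, par v) ≠ s(a, b)) ∧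
      ∀ u v, G.Adj u v → (u ≠ p ∧ v = par u) ∨ (v ≠ p ∧ u = par v) ∨ s(u, v) = s(a, b) := by
    rintro a b rfl
    have hmem : s(a, b) ∈ G.edgeFinset \ T := by simp [he]
    rw [Finset.mem_sdiff] at hmem
    refine ⟨by simpa using hmem.1, fun v hv hve => hmem.2 ?_, fun u v huv => ?_⟩
    · rw [← hve]
      exact Finset.mem_image.2 ⟨v, by simpa using hv, rfl⟩
    · by_cases hTm : s(u, v) ∈ T
      · obtain ⟨w, hw, hwe⟩ := Finset.mem_image.1 hTm
        have hw : w ≠ p := by simpa using hw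
        rw [Sym2.eq_iff] at hwe
        rcases hwe with ⟨rfl, rfl⟩ | ⟨rfl, rfl⟩
        · exact Or.inl ⟨hw, rfl⟩
        · exact Or.inr (Or.inl ⟨hw, rfl⟩)
      · have : s(u, v) ∈ G.edgeFinset \ T := by
          rw [Finset.mem_sdiff]
          exact ⟨by simpa using huv, hTm⟩
        rw [he, Finset.mem_singleton] at this
        exact Or.inr (Or.inr this)
  induction e with
  | _ a b =>
    rcases le_total (G.dist p b) (G.dist p a) with hle | hle
    · obtain ⟨h1, h2, h3⟩ := main a b rfl
      exact ⟨a, b, h1, hle, h2, h3⟩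
    · obtain ⟨h1, h2, h3⟩ := main b a Sym2.eq_swap
      exact ⟨b, a, h1, hle, h2, h3⟩

end IsParent

variable [Fintype V]

/-- In a unicyclic graph, resistances from `p` add up to at least `2 / 3` less than distances. -/
lemma kirchhoffAt_le {G : SimpleGraph V} (hG : G.Connected)
    (hE : G.edgeFinset.card = Fintype.card V) (p : V) :
    kirchhoffAt G p ≤ wienerAt G p - 2 / 3 := by
  obtain ⟨par, h⟩ := exists_isParent hG p
  obtain ⟨a, b, hab, hle, hne, -⟩ := h.exists_extra_edge hE
  obtain ⟨A, hcA, hA, hA', hmA, hpA, hfA⟩ := h.exists_ancestors a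
  obtain ⟨B, hcB, hB, hB', hmB, -, hfB⟩ := h.exists_ancestors b
  have hAp : ∀ u ∈ A, u ≠ p := fun u hu => (hA u hu).1
  have hBp : ∀ u ∈ B, u ≠ p := fun u hu => (hB u hu).1
  have hterm : ∀ v, 0 ≤ (G.dist p v : ℝ) - resistanceDistance G p v := fun v =>
    sub_nonneg.2 (IsParent.resistanceDistance_le_dist hG p v)
  suffices hs : 2 / 3 ≤ ∑ v, ((G.dist p v : ℝ) - resistanceDistance G p v) by
    rw [Finset.sum_sub_distrib] at hs
    unfold kirchhoffAt wienerAt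
    linarith
  have hABcard : (A \ B).card + B.card = (B \ A).card + A.card := by
    have h1 := Finset.card_sdiff_add_card_inter A B
    have h2 := Finset.card_sdiff_add_card_inter B A
    rw [Finset.inter_comm] at h2
    omega
  have ra := h.resistanceDistance_le_detour hab hne hAp hBp hfA hfB
  rw [resistanceDistance_comm hG] at ra
  have hstep := dist_le_succ_of_adj hG p hab.symm
  have hap : a ≠ p := by
    rintro rfl
    rw [SimpleGraph.dist_self, Nat.le_zero, hG.dist_eq_zero_iff] at hle
    exact hab.ne hle
  have haB : a ∉ B := fun haB => hab.ne (hB' a haB (by have := (hB a haB).2; omega))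
  rcases hle.lt_or_eq with hlt | heq
  · have hpar : par a ≠ b := fun hp => hne a hap (by rw [hp])
    have hda := h.dist a hap
    have hparp : par a ≠ p := by
      intro hp
      rw [hp, SimpleGraph.dist_self] at hda
      have hb0 : G.dist p b = 0 := by omega
      rw [hG.dist_eq_zero_iff] at hb0
      exact hpar (hp.trans hb0)
    have hparB : par a ∉ B := fun hm => hpar (hB' _ hm (by omega))
    have h2 : 2 ≤ (A \ B).card := by
      rw [← Finset.card_pair (h.adj a hap).ne]
      refine Finset.card_le_card fun u hu => ?_
      rcases Finset.mem_insert.1 hu with rfl | hu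
      · exact Finset.mem_sdiff.2 ⟨hmA hap, haB⟩
      · rw [Finset.mem_singleton.1 hu]
        exact Finset.mem_sdiff.2 ⟨hpA hap hparp, hparB⟩
    have hcard : (A \ B).card = (B \ A).card + 1 := by omega
    have ra := ra (1 / 2)
    rw [hcA, hcard] at ra
    rw [hcard] at h2
    have h2' : (1 : ℝ) ≤ (B \ A).card := by exact_mod_cast (by omega : 1 ≤ (B \ A).card)
    push_cast at ra
    have := Finset.single_le_sum (fun v _ => hterm v) (Finset.mem_univ a)
    linarith
  · have hbp : b ≠ p := by
      rintro rfl
      rw [SimpleGraph.dist_self] at heq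
      exact hap (hG.dist_eq_zero_iff.1 heq.symm).symm
    have hbA : b ∉ A := fun hm => hab.ne.symm (hA' b hm heq)
    have rb := h.resistanceDistance_le_detour hab.symm
      (fun v hv => by rw [Sym2.eq_swap (a := b)]; exact hne v hv) hBp hAp hfB hfA (1 / 3)
    rw [resistanceDistance_comm hG] at rb
    have ra := ra (1 / 3)
    have h1 : 1 ≤ (A \ B).card :=
      Finset.card_pos.2 ⟨a, Finset.mem_sdiff.2 ⟨hmA hap, haB⟩⟩
    have hcard : (A \ B).card = (B \ A).card := by omega
    rw [hcard] at h1
    rw [hcA, hcard] at ra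
    rw [hcB, hcard] at rb
    have h1' : (1 : ℝ) ≤ (B \ A).card := by exact_mod_cast h1
    have hpair := Finset.sum_le_sum_of_subset_of_nonneg
      (f := fun v => (G.dist p v : ℝ) - resistanceDistance G p v)
      (Finset.subset_univ {a, b}) (fun v _ _ => hterm v)
    rw [Finset.sum_pair hab.ne] at hpair
    linarith

end Layers

section Distances

variable {G : SimpleGraph V}

lemma sum_layers_deficit {p : V} {M : ℕ} {ρ : ℕ → V} (hρ : ∀ j ≤ M, G.dist p (ρ j) = j)
    (J : Finset ℕ) (hJ : ∀ j ∈ J, j ≤ M) :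
    ∑ v ∈ J.image ρ, ((M : ℝ) - G.dist p v) = ∑ j ∈ J, ((M : ℝ) - j) := by
  rw [Finset.sum_image]
  · exact Finset.sum_congr rfl fun j hj => by rw [hρ j (hJ j hj)]
  · intro j hj k hk hjk
    rw [← hρ j (hJ j hj), ← hρ k (hJ k hk), hjk]

variable [Fintype V]

lemma exists_layers (hG : G.Connected) (p : V) :
    ∃ (M : ℕ) (ρ : ℕ → V), (∀ v, G.dist p v ≤ M) ∧ ∀ j ≤ M, G.dist p (ρ j) = j := by
  obtain ⟨par, h⟩ := exists_isParent hG p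
  obtain ⟨z, -, hz⟩ := Finset.exists_max_image Finset.univ (G.dist p) ⟨p, Finset.mem_univ p⟩
  have key : ∀ j, ∃ u, j ≤ G.dist p z → G.dist p u = j := by
    intro j
    by_cases hj : j ≤ G.dist p z
    · obtain ⟨u, hu⟩ := h.exists_dist_eq z hj
      exact ⟨u, fun _ => hu⟩
    · exact ⟨p, fun hj' => absurd hj' hj⟩
  choose ρ hρ using key
  exact ⟨G.dist p z, ρ, fun v => hz v (Finset.mem_univ v), hρ⟩

/-- A vertex of degree `Δ` bounds the number of layers around any vertex. -/
lemma layers_add_degree_le (hG : G.Connected) {p w : V} {M : ℕ} {ρ : ℕ → V}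
    (hρ : ∀ j ≤ M, G.dist p (ρ j) = j) : M + G.degree w ≤ Fintype.card V + 1 := by
  set i := G.dist p w with hi
  set J := (Finset.range (M + 1)).filter fun j => j + 2 ≤ i ∨ i + 2 ≤ j with hJ
  have hJM : ∀ j ∈ J, j ≤ M ∧ (j + 2 ≤ i ∨ i + 2 ≤ j) := fun j hj => by
    simp only [hJ, Finset.mem_filter, Finset.mem_range] at hj
    exact ⟨by omega, hj.2⟩
  have hcover : Finset.range (M + 1) ⊆ J ∪ {i - 1, i, i + 1} := by
    intro j hj
    simp only [hJ, Finset.mem_union, Finset.mem_filter, Finset.mem_insert, Finset.mem_singleton]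
    by_cases h : j + 2 ≤ i ∨ i + 2 ≤ j
    · exact Or.inl ⟨hj, h⟩
    · right
      omega
  have h1 : M + 1 ≤ J.card + 3 := by
    have h2 := Finset.card_le_card hcover
    rw [Finset.card_range] at h2
    exact h2.trans ((Finset.card_union_le _ _).trans (Nat.add_le_add_left Finset.card_le_three _))
  have h2 : (J.image ρ).card = J.card := by
    refine Finset.card_image_of_injOn fun j hj k hk hjk => ?_
    rw [← hρ j (hJM j hj).1, ← hρ k (hJM k hk).1, hjk]
  have h3 : (insert w (G.neighborFinset w)).card = G.degree w + 1 := by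
    rw [Finset.card_insert_of_notMem (by simp), SimpleGraph.card_neighborFinset_eq_degree]
  have hdisj : Disjoint (J.image ρ) (insert w (G.neighborFinset w)) := by
    rw [Finset.disjoint_left]
    intro v hv hvw
    obtain ⟨j, hj, rfl⟩ := Finset.mem_image.1 hv
    have hdj := hρ j (hJM j hj).1
    have hj2 := (hJM j hj).2
    rcases Finset.mem_insert.1 hvw with h | h
    · rw [h] at hdj
      omega
    · rw [SimpleGraph.mem_neighborFinset] at h
      have := dist_le_succ_of_adj hG p h
      have := dist_le_succ_of_adj hG p h.symm
      omega
  have h4 := Finset.card_le_univ (J.image ρ ∪ insert w (G.neighborFinset w))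
  rw [Finset.card_union_of_disjoint hdisj, h2, h3] at h4
  omega

/-- The distance deficits of any set of vertices bound the sum of all distances. -/
lemma wienerAt_le_sub_sum {p : V} {M : ℕ} (hM : ∀ v, G.dist p v ≤ M) (s : Finset V) :
    wienerAt G p ≤ Fintype.card V * M - ∑ v ∈ s, ((M : ℝ) - G.dist p v) := by
  have h := Finset.sum_le_sum_of_subset_of_nonneg
    (f := fun v => (M : ℝ) - G.dist p v) (Finset.subset_univ s)
    (fun v _ _ => sub_nonneg.2 (by exact_mod_cast hM v))
  have htotal : ∑ v, ((M : ℝ) - G.dist p v) = Fintype.card V * M - wienerAt G p := by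
    rw [Finset.sum_sub_distrib, Finset.sum_const, Finset.card_univ, nsmul_eq_mul, wienerAt]
  linarith

lemma sum_range_deficit (M : ℕ) :
    ∑ j ∈ Finset.range (M + 1), ((M : ℝ) - j) = M * (M + 1) / 2 := by
  rw [Finset.sum_sub_distrib, Finset.sum_const, Finset.card_range, nsmul_eq_mul]
  have h : ∑ j ∈ Finset.range (M + 1), (j : ℝ) = M * (M + 1) / 2 := by
    induction M with
    | zero => simp
    | succ k ih =>
      rw [Finset.sum_range_succ, ih]
      push_cast
      ring
  rw [h]
  push_cast
  ring

/-- The largest possible sum of distances from a vertex, and the shape of the layers when it is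
attained: all of them but the last are singletons. -/
lemma wienerAt_le (hG : G.Connected) (p : V) {w : V} {Δ : ℕ} (hΔ : 3 ≤ Δ) (hw : Δ ≤ G.degree w) :
    let m : ℝ := (Fintype.card V : ℝ) - Δ
    wienerAt G p ≤ Fintype.card V * (m + 1) - (m + 1) * (m + 2) / 2 ∧
    (wienerAt G p = Fintype.card V * (m + 1) - (m + 1) * (m + 2) / 2 →
      ∃ ρ : ℕ → V, (∀ v, G.dist p v ≤ Fintype.card V + 1 - Δ) ∧
        (∀ j ≤ Fintype.card V + 1 - Δ, G.dist p (ρ j) = j) ∧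
        ∀ v, G.dist p v < Fintype.card V + 1 - Δ → v = ρ (G.dist p v)) := by
  intro m
  obtain ⟨M, ρ, hM, hρ⟩ := exists_layers hG p
  have hMle := layers_add_degree_le hG (w := w) hρ
  have hrange : ∀ j ∈ Finset.range (M + 1), j ≤ M := fun j hj => by
    rw [Finset.mem_range] at hj
    omega
  have hW := wienerAt_le_sub_sum hM ((Finset.range (M + 1)).image ρ)
  rw [sum_layers_deficit hρ _ hrange, sum_range_deficit] at hW
  have hMr : (M : ℝ) ≤ m + 1 := by
    have : ((M + Δ : ℕ) : ℝ) ≤ ((Fintype.card V + 1 : ℕ) : ℝ) := by exact_mod_cast (by omega)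
    push_cast at this
    simp only [m]
    linarith
  have hΔr : (3 : ℝ) ≤ Δ := by exact_mod_cast hΔ
  have hcard : (Fintype.card V : ℝ) = m + Δ := by simp [m]
  have hmono : (Fintype.card V : ℝ) * M - M * (M + 1) / 2 + (m + 1 - M)
      ≤ Fintype.card V * (m + 1) - (m + 1) * (m + 2) / 2 := by
    rw [hcard]
    nlinarith [mul_nonneg (sub_nonneg.2 hMr) (sub_nonneg.2 hΔr),
      mul_nonneg (sub_nonneg.2 hMr) (sub_nonneg.2 hMr)]
  refine ⟨by linarith, fun heq => ?_⟩
  have hMeq : M = Fintype.card V + 1 - Δ := by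
    have h1 : m + 1 ≤ M := by linarith
    have h2 : ((Fintype.card V + 1 : ℕ) : ℝ) ≤ ((M + Δ : ℕ) : ℝ) := by
      push_cast
      linarith
    have h3 : Fintype.card V + 1 ≤ M + Δ := by exact_mod_cast h2
    omega
  rw [← hMeq]
  refine ⟨ρ, hM, hρ, fun v hv => ?_⟩
  by_contra hne
  have hnot : v ∉ (Finset.range (M + 1)).image ρ := fun hmem => by
    obtain ⟨j, hj, rfl⟩ := Finset.mem_image.1 hmem
    rw [hρ j (hrange j hj)] at hne
    exact hne rfl
  have hW' := wienerAt_le_sub_sum hM (insert v ((Finset.range (M + 1)).image ρ))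
  rw [Finset.sum_insert hnot, sum_layers_deficit hρ _ hrange, sum_range_deficit] at hW'
  have : (G.dist p v : ℝ) < M := by exact_mod_cast hv
  linarith

lemma sum_range_deficit_tail (M : ℕ) (hM : 2 ≤ M) :
    ∑ j ∈ Finset.Icc 3 M, ((M : ℝ) - j) = (M - 2) * (M - 3) / 2 := by
  obtain ⟨k, rfl⟩ := Nat.exists_eq_add_of_le' hM
  induction k with
  | zero => simp
  | succ k ih =>
    have ih := ih (by omega)
    have hshift : ∑ j ∈ Finset.Icc 3 (k + 2), (((k + 1 + 2 : ℕ) : ℝ) - j)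
        = ∑ j ∈ Finset.Icc 3 (k + 2), (((k + 2 : ℕ) : ℝ) - j) + k := by
      have : ∀ j ∈ Finset.Icc 3 (k + 2), (((k + 1 + 2 : ℕ) : ℝ) - j)
          = (((k + 2 : ℕ) : ℝ) - j) + 1 := fun j _ => by push_cast; ring
      rw [Finset.sum_congr rfl this, Finset.sum_add_distrib]
      simp
    rw [show k + 1 + 2 = (k + 2) + 1 by ring, Finset.sum_Icc_succ_top (by omega)]
    rw [show k + 2 + 1 = k + 1 + 2 by ring, hshift, ih]
    push_cast
    ring

/-- The largest possible sum of distances from a pendant vertex attached to a vertex of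
degree `Δ`. -/
lemma wienerAt_pendant_le (hG : G.Connected) {p w : V} {Δ : ℕ} (hΔ : 3 ≤ Δ)
    (hw : Δ ≤ G.degree w) (hp : ∀ x, G.Adj p x ↔ x = w) :
    let m : ℝ := (Fintype.card V : ℝ) - Δ
    wienerAt G p ≤ Fintype.card V * (m + 1) - (m + 1) - m - (Δ - 1) * (m - 1)
      - (m - 1) * (m - 2) / 2 := by
  intro m
  obtain ⟨M, ρ, hM, hρ⟩ := exists_layers hG p
  have hMle := layers_add_degree_le hG (w := w) hρ
  have hpw : G.Adj p w := (hp w).2 rfl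
  have hN : ∀ v ∈ (G.neighborFinset w).erase p, G.dist p v = 2 := by
    intro v hv
    rw [Finset.mem_erase, SimpleGraph.mem_neighborFinset] at hv
    have h1 := dist_le_succ_of_adj hG p hv.2
    rw [SimpleGraph.dist_eq_one_iff_adj.2 hpw] at h1
    have h2 : G.dist p v ≠ 0 := fun h => hv.1 (hG.dist_eq_zero_iff.1 h).symm
    have h3 : G.dist p v ≠ 1 := fun h => by
      rw [SimpleGraph.dist_eq_one_iff_adj, hp] at h
      exact hv.2.ne h.symm
    omega
  have hNcard : ((G.neighborFinset w).erase p).card = G.degree w - 1 := by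
    rw [Finset.card_erase_of_mem (by simpa using hpw.symm),
      SimpleGraph.card_neighborFinset_eq_degree]
  have hM2 : 2 ≤ M := by
    obtain ⟨v, hv⟩ := Finset.card_pos.1 (by omega : 0 < ((G.neighborFinset w).erase p).card)
    rw [← hN v hv]
    exact hM v
  have hdw : G.dist p w = 1 := SimpleGraph.dist_eq_one_iff_adj.2 hpw
  have hIcc : ∀ j ∈ Finset.Icc 3 M, j ≤ M := fun j hj => (Finset.mem_Icc.1 hj).2
  have hR : ∀ v ∈ (Finset.Icc 3 M).image ρ, 3 ≤ G.dist p v := by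
    intro v hv
    obtain ⟨j, hj, rfl⟩ := Finset.mem_image.1 hv
    rw [hρ j (hIcc j hj)]
    exact (Finset.mem_Icc.1 hj).1
  have hdisj : Disjoint ((G.neighborFinset w).erase p) ((Finset.Icc 3 M).image ρ) := by
    rw [Finset.disjoint_left]
    intro v h1 h2
    have := hN v h1
    have := hR v h2
    omega
  have hw' : w ∉ (G.neighborFinset w).erase p ∪ (Finset.Icc 3 M).image ρ := by
    rw [Finset.mem_union]
    rintro (h | h)
    · have := hN w h
      omega
    · have := hR w h
      omega
  have hp' : p ∉ insert w ((G.neighborFinset w).erase p ∪ (Finset.Icc 3 M).image ρ) := by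
    rw [Finset.mem_insert, Finset.mem_union]
    rintro (h | h | h)
    · exact hpw.ne h
    · simp at h
    · have := hR p h
      simp at this
  have hW := wienerAt_le_sub_sum hM
    (insert p (insert w ((G.neighborFinset w).erase p ∪ (Finset.Icc 3 M).image ρ)))
  have hNsum : ∑ v ∈ (G.neighborFinset w).erase p, ((M : ℝ) - G.dist p v)
      = (G.degree w - 1) * (M - 2) := by
    rw [Finset.sum_congr rfl (fun v hv => by rw [hN v hv]), Finset.sum_const, hNcard, nsmul_eq_mul,
      Nat.cast_sub (by omega)]
    push_cast
    ring
  rw [Finset.sum_insert hp', Finset.sum_insert hw', Finset.sum_union hdisj, hNsum,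
    sum_layers_deficit hρ _ hIcc, sum_range_deficit_tail M hM2, hdw, SimpleGraph.dist_self] at hW
  have hMr : (M : ℝ) ≤ m + 1 := by
    have : ((M + Δ : ℕ) : ℝ) ≤ ((Fintype.card V + 1 : ℕ) : ℝ) := by exact_mod_cast (by omega)
    push_cast at this
    simp only [m]
    linarith
  have hM2r : (2 : ℝ) ≤ M := by exact_mod_cast hM2
  have hwr : (Δ : ℝ) ≤ G.degree w := by exact_mod_cast hw
  have hcard : (Fintype.card V : ℝ) = m + Δ := by simp [m]
  rw [hcard] at hW ⊢
  push_cast at hW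
  nlinarith [mul_nonneg (sub_nonneg.2 hwr) (sub_nonneg.2 hM2r),
    mul_nonneg (sub_nonneg.2 hMr) (sub_nonneg.2 hMr)]

end Distances

lemma degree_eq_sum [Fintype V] (G : SimpleGraph V) (v : V) :
    G.degree v = ∑ x, if G.Adj v x then 1 else 0 := by
  rw [Finset.sum_boole, SimpleGraph.degree, SimpleGraph.neighborFinset_eq_filter]
  simp

/-- `G` is obtained from `G'`, embedded by `ι`, by attaching the pendant vertex `p` to `ι q`. -/
structure IsPendantExt (G' : SimpleGraph W) (G : SimpleGraph V) (ι : W → V) (p : V) (q : W) :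
    Prop where
  inj : Function.Injective ι
  ne : ∀ a, ι a ≠ p
  surj : ∀ v, v ≠ p → ∃ a, ι a = v
  adj_iff : ∀ a b, G.Adj (ι a) (ι b) ↔ G'.Adj a b
  adj_pendant : ∀ x, G.Adj p x ↔ x = ι q

lemma isPendantExt_induce {G : SimpleGraph V} {p w : V} (hp : ∀ x, G.Adj p x ↔ x = w) :
    ∃ q : ↥({p}ᶜ : Set V), IsPendantExt (G.induce {p}ᶜ) G Subtype.val p q := by
  have hne : w ≠ p := ((hp w).2 rfl).ne'
  exact ⟨⟨w, hne⟩, Subtype.val_injective, fun a => a.2, fun v hv => ⟨⟨v, hv⟩, rfl⟩,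
    fun a b => Iff.rfl, hp⟩

namespace IsPendantExt

variable {G' : SimpleGraph W} {G : SimpleGraph V} {ι : W → V} {p : V} {q : W}

lemma connected (h : IsPendantExt G' G ι p q) (hG' : G'.Connected) : G.Connected := by
  let φ : G' →g G := ⟨ι, fun {a b} hab => (h.adj_iff a b).2 hab⟩
  rw [SimpleGraph.connected_iff_exists_forall_reachable]
  refine ⟨ι q, fun v => ?_⟩
  by_cases hv : v = p
  · rw [hv]
    exact ((h.adj_pendant _).2 rfl).symm.reachable
  · obtain ⟨a, rfl⟩ := h.surj v hv
    exact (hG'.preconnected q a).map φ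

variable [Fintype V]

lemma degree_pendant (h : IsPendantExt G' G ι p q) : G.degree p = 1 := by
  rw [SimpleGraph.degree, Finset.card_eq_one]
  exact ⟨ι q, by ext x; simp [h.adj_pendant]⟩

variable [Fintype W]

lemma sum_eq {M : Type*} [AddCommMonoid M] (h : IsPendantExt G' G ι p q) (F : V → M) :
    ∑ v, F v = F p + ∑ a, F (ι a) := by
  have hu : (Finset.univ : Finset V) = insert p (Finset.univ.image ι) := by
    ext v
    simp only [Finset.mem_univ, Finset.mem_insert, Finset.mem_image, true_and, true_iff]
    exact (em (v = p)).imp id (h.surj v)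
  rw [hu, Finset.sum_insert, Finset.sum_image h.inj.injOn]
  simpa using h.ne

lemma card_eq (h : IsPendantExt G' G ι p q) : Fintype.card V = Fintype.card W + 1 := by
  have := h.sum_eq (fun _ => 1)
  simp only [Finset.sum_const, Finset.card_univ, smul_eq_mul, mul_one] at this
  omega

lemma energy_eq (h : IsPendantExt G' G ι p q) (f : V → ℝ) :
    energy G f = energy G' (f ∘ ι) + (f p - f (ι q)) ^ 2 := by
  have h1 : ∀ a, (if G.Adj (ι a) p then (f (ι a) - f p) ^ 2 else 0) =
      if a = q then (f p - f (ι q)) ^ 2 else 0 := by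
    intro a
    rw [G.adj_comm, h.adj_pendant, h.inj.eq_iff]
    split_ifs with ha
    · rw [ha]
      ring
    · rfl
  have h2 : ∀ a, (if G.Adj p (ι a) then (f p - f (ι a)) ^ 2 else 0) =
      if a = q then (f p - f (ι q)) ^ 2 else 0 := by
    intro a
    rw [h.adj_pendant, h.inj.eq_iff]
    split_ifs with ha
    · rw [ha]
    · rfl
  unfold energy
  simp_rw [h.sum_eq, h1, h2, Finset.sum_add_distrib, h.adj_iff]
  simp
  ring

lemma degree_eq (h : IsPendantExt G' G ι p q) (a : W) :
    G.degree (ι a) = G'.degree a + if a = q then 1 else 0 := by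
  rw [degree_eq_sum, degree_eq_sum, h.sum_eq, add_comm]
  simp_rw [h.adj_iff, G.adj_comm _ p, h.adj_pendant, h.inj.eq_iff]

lemma card_edges (h : IsPendantExt G' G ι p q) :
    G.edgeFinset.card = G'.edgeFinset.card + 1 := by
  have h1 := G.sum_degrees_eq_twice_card_edges
  have h2 := G'.sum_degrees_eq_twice_card_edges
  rw [h.sum_eq, h.degree_pendant] at h1
  simp_rw [h.degree_eq, Finset.sum_add_distrib] at h1
  simp at h1
  omega

/-- The potential on the extension with value `t` at the pendant vertex. -/
lemma exists_extend (h : IsPendantExt G' G ι p q) (f : W → ℝ) (t : ℝ) :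
    ∃ g : V → ℝ, (∀ a, g (ι a) = f a) ∧ g p = t ∧ energy G g = energy G' f + (t - f q) ^ 2 := by
  have h1 : ∀ a, Function.extend ι f (fun _ => t) (ι a) = f a := fun a => h.inj.extend_apply _ _ a
  have h2 : Function.extend ι f (fun _ => t) p = t := by
    rw [Function.extend_apply']
    rintro ⟨a, ha⟩
    exact h.ne a ha
  refine ⟨_, h1, h2, ?_⟩
  rw [h.energy_eq, h1, h2]
  congr 2
  exact funext h1

lemma resistanceDistance_eq (h : IsPendantExt G' G ι p q) (hG' : G'.Connected) (u v : W) :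
    resistanceDistance G (ι u) (ι v) = resistanceDistance G' u v := by
  apply le_antisymm
  · refine resistanceDistance_le (resistanceDistance_nonneg _ _ _) fun f => ?_
    refine (sq_le_resistanceDistance_mul_energy (hG'.preconnected u v) (f ∘ ι)).trans ?_
    refine mul_le_mul_of_nonneg_left ?_ (resistanceDistance_nonneg _ _ _)
    rw [h.energy_eq]
    nlinarith
  · refine resistanceDistance_le (resistanceDistance_nonneg _ _ _) fun f => ?_
    obtain ⟨g, hg, -, hE⟩ := h.exists_extend f (f q)
    have := sq_le_resistanceDistance_mul_energy ((h.connected hG').preconnected (ι u) (ι v)) g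
    rwa [hg, hg, hE, sub_self, zero_pow two_ne_zero, add_zero] at this

lemma one_add_resistanceDistance_le (h : IsPendantExt G' G ι p q) (hG' : G'.Connected) (v : W) :
    1 + resistanceDistance G' q v ≤ resistanceDistance G p (ι v) := by
  set r := resistanceDistance G p (ι v)
  have key : ∀ (f : W → ℝ) (s : ℝ), (f q - f v + s) ^ 2 ≤ r * (energy G' f + s ^ 2) := by
    intro f s
    obtain ⟨g, hg, hgp, hE⟩ := h.exists_extend f (f q + s)
    have := sq_le_resistanceDistance_mul_energy ((h.connected hG').preconnected p (ι v)) g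
    rw [hg, hE, hgp, add_sub_cancel_left] at this
    convert this using 2
    ring
  have hr : 1 ≤ r := by
    have := key 0 1
    have h0 : energy G' (0 : W → ℝ) = 0 := by simp [energy]
    simpa [h0] using this
  suffices resistanceDistance G' q v ≤ r - 1 by linarith
  refine resistanceDistance_le (by linarith) fun f => ?_
  have hE := energy_nonneg G' f
  by_cases hδ : f q - f v = 0
  · rw [hδ, zero_pow two_ne_zero]
    exact mul_nonneg (by linarith) hE
  have hδ2 : 0 < (f q - f v) ^ 2 := by positivity
  have h1 := key f (energy G' f / (f q - f v))
  set δ := f q - f v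
  set E := energy G' f
  have e1 : (δ + E / δ) ^ 2 = (δ ^ 2 + E) * (δ ^ 2 + E) / δ ^ 2 := by field_simp
  have e2 : r * (E + (E / δ) ^ 2) = (δ ^ 2 + E) * (r * E) / δ ^ 2 := by field_simp
  rw [e1, e2, div_le_div_iff_of_pos_right hδ2] at h1
  have := le_of_mul_le_mul_left h1 (by positivity)
  linarith

lemma kirchhoffIndex_eq (h : IsPendantExt G' G ι p q) (hG' : G'.Connected) :
    kirchhoffIndex G = kirchhoffIndex G' + kirchhoffAt G p := by
  have hG := h.connected hG'
  unfold kirchhoffIndex kirchhoffAt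
  simp_rw [h.sum_eq, Finset.sum_add_distrib, h.resistanceDistance_eq hG',
    resistanceDistance_self, fun a => resistanceDistance_comm hG (ι a) p]
  ring

lemma card_add_kirchhoffAt_le (h : IsPendantExt G' G ι p q) (hG' : G'.Connected) :
    Fintype.card W + kirchhoffAt G' q ≤ kirchhoffAt G p := by
  unfold kirchhoffAt
  rw [h.sum_eq, resistanceDistance_self, zero_add]
  have := Finset.sum_le_sum (s := Finset.univ) fun v _ => h.one_add_resistanceDistance_le hG' v
  simpa [Finset.sum_add_distrib] using this

end IsPendantExt

section Cycle

variable [Fintype V] {G : SimpleGraph V}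

lemma exists_cyclic_enumeration (hG : G.Connected) (hdeg : ∀ v, G.degree v = 2) (v : V) :
    3 ≤ Fintype.card V ∧ ∃ c : ℕ → V, c 0 = v ∧ c (Fintype.card V) = v ∧
      (∀ i < Fintype.card V, G.Adj (c i) (c (i + 1))) ∧
      (∀ i < Fintype.card V, ∀ j < Fintype.card V, c i = c j → i = j) ∧
      ∀ u, ∃ i < Fintype.card V, c i = u := by
  have hcyc : G.IsCycles := fun u _ => by
    rw [Set.ncard_eq_toFinset_card', ← SimpleGraph.neighborFinset_def]
    exact hdeg u
  have hne : (G.neighborSet v).Nonempty := by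
    have h := G.card_neighborSet_eq_degree v
    rw [hdeg v] at h
    exact Set.nonempty_coe_sort.1 (Fintype.card_pos_iff.1 (by omega))
  obtain ⟨p, hp, hverts⟩ := hcyc.exists_cycle_toSubgraph_verts_eq_connectedComponentSupp
    (c := G.connectedComponentMk v) rfl hne
  have h3 := hp.three_le_length
  have hinj : ∀ i < p.length, ∀ j < p.length, p.getVert i = p.getVert j → i = j :=
    fun i hi j hj h => hp.getVert_injOn' (by simp; omega) (by simp; omega) h
  have hsurj : ∀ u, ∃ i < p.length, p.getVert i = u := by
    intro u
    have hu : u ∈ p.toSubgraph.verts := by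
      rw [hverts]
      exact SimpleGraph.ConnectedComponent.sound (hG.preconnected u v)
    rw [p.mem_verts_toSubgraph, SimpleGraph.Walk.mem_support_iff_exists_getVert] at hu
    obtain ⟨i, hi, hle⟩ := hu
    rcases hle.lt_or_eq with h | h
    · exact ⟨i, h, hi⟩
    · refine ⟨0, by omega, ?_⟩
      rw [← hi, h, p.getVert_length, p.getVert_zero]
  have hlen : p.length = Fintype.card V := by
    have himg : (Finset.range p.length).image p.getVert = Finset.univ := by
      ext u
      simpa using hsurj u
    rw [← Finset.card_univ, ← himg, Finset.card_image_of_injOn, Finset.card_range]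
    intro i hi j hj h
    simp only [Finset.coe_range, Set.mem_Iio] at hi hj
    exact hinj i hi j hj h
  rw [← hlen]
  exact ⟨h3, p.getVert, p.getVert_zero, p.getVert_length, fun i hi => p.adj_getVert_succ hi,
    hinj, hsurj⟩

lemma resistanceDistance_cycle_le {n : ℕ} (hn : 3 ≤ n) {c : ℕ → V} (hc : c n = c 0)
    (hadj : ∀ i < n, G.Adj (c i) (c (i + 1)))
    (hinj : ∀ i < n, ∀ j < n, c i = c j → i = j) {k : ℕ} (hk : k < n) :
    resistanceDistance G (c 0) (c k) ≤ k * (n - k) / n := by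
  have hn0 : (n : ℝ) ≠ 0 := by positivity
  obtain ⟨m, rfl⟩ := Nat.exists_eq_add_of_le hk.le
  have hnext : ∀ i < k + m, ∀ j < k + m, c i = c (j + 1) → i = j + 1 ∨ i = 0 ∧ j + 1 = k + m := by
    intro i hi j hj h
    by_cases hj' : j + 1 = k + m
    · rw [hj', hc] at h
      exact Or.inr ⟨hinj i hi 0 (by omega) h, hj'⟩
    · exact Or.inl (hinj i hi _ (by omega) h)
  refine (resistanceDistance_le_of_flow (Finset.range (k + m)) c (fun i => c (i + 1))
    (fun i => if i < k then (m : ℝ) / (k + m : ℕ) else -(k / (k + m : ℕ)))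
    (fun i hi => hadj i (Finset.mem_range.1 hi)) ?_ ?_).trans (le_of_eq ?_)
  · intro i hi j hj h
    rw [Finset.mem_range] at hi hj
    rw [Sym2.eq_iff] at h
    rcases h with h | h
    · exact hinj i hi j hj h.1
    · have h1 := hnext i hi j hj h.1
      have h2 := hnext j hj i hi h.2.symm
      omega
  · intro f
    rw [Finset.sum_range_add]
    have e1 : ∀ i ∈ Finset.range k,
        (if i < k then (m : ℝ) / (k + m : ℕ) else -(k / (k + m : ℕ))) * (f (c i) - f (c (i + 1)))
          = (m : ℝ) / (k + m : ℕ) * (f (c i) - f (c (i + 1))) := fun i hi => by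
      rw [if_pos (Finset.mem_range.1 hi)]
    have e2 : ∀ i ∈ Finset.range m,
        (if k + i < k then (m : ℝ) / (k + m : ℕ) else -(k / (k + m : ℕ)))
            * (f (c (k + i)) - f (c (k + i + 1)))
          = -((k : ℝ) / (k + m : ℕ)) * (f (c (k + i)) - f (c (k + (i + 1)))) := fun i _ => by
      rw [if_neg (by omega), add_assoc]
    rw [Finset.sum_congr rfl e1, Finset.sum_congr rfl e2, ← Finset.mul_sum, ← Finset.mul_sum,
      Finset.sum_range_sub' (fun i => f (c i)), Finset.sum_range_sub' (fun i => f (c (k + i))),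
      hc, add_zero]
    field_simp
    push_cast
    ring
  · rw [Finset.sum_range_add]
    have e1 : ∀ i ∈ Finset.range k,
        (if i < k then (m : ℝ) / (k + m : ℕ) else -(k / (k + m : ℕ))) ^ 2
          = ((m : ℝ) / (k + m : ℕ)) ^ 2 := fun i hi => by rw [if_pos (Finset.mem_range.1 hi)]
    have e2 : ∀ i ∈ Finset.range m,
        (if k + i < k then (m : ℝ) / (k + m : ℕ) else -(k / (k + m : ℕ))) ^ 2
          = ((k : ℝ) / (k + m : ℕ)) ^ 2 := fun i _ => by
      rw [if_neg (by omega), neg_sq]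
    rw [Finset.sum_congr rfl e1, Finset.sum_congr rfl e2]
    simp only [Finset.sum_const, Finset.card_range, nsmul_eq_mul]
    field_simp
    push_cast
    ring

lemma kirchhoffAt_cycle_le (hG : G.Connected) (hdeg : ∀ v, G.degree v = 2) (v : V) :
    kirchhoffAt G v ≤ ((Fintype.card V : ℝ) ^ 2 - 1) / 6 := by
  obtain ⟨h3, c, h0, hend, hadj, hinj, hsurj⟩ := exists_cyclic_enumeration hG hdeg v
  set n := Fintype.card V
  have himg : (Finset.range n).image c = Finset.univ := by
    ext u
    simpa using hsurj u
  have hsum : ∀ m : ℕ, ∑ k ∈ Finset.range m, (k * (n - k) : ℝ)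
      = n * (m * (m - 1) / 2) - m * (m - 1) * (2 * m - 1) / 6 := by
    intro m
    induction m with
    | zero => simp
    | succ j ih =>
      rw [Finset.sum_range_succ, ih]
      push_cast
      ring
  have hn0 : (n : ℝ) ≠ 0 := by positivity
  unfold kirchhoffAt
  rw [← himg, Finset.sum_image fun i hi j hj h =>
    hinj i (by simpa using hi) j (by simpa using hj) h]
  calc ∑ k ∈ Finset.range n, resistanceDistance G v (c k)
      ≤ ∑ k ∈ Finset.range n, (k * (n - k) : ℝ) / n := by
        refine Finset.sum_le_sum fun k hk => ?_
        rw [← h0]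
        exact resistanceDistance_cycle_le h3 (hend.trans h0.symm) hadj hinj (Finset.mem_range.1 hk)
    _ = ((n : ℝ) ^ 2 - 1) / 6 := by
        rw [← Finset.sum_div, hsum]
        field_simp
        ring

lemma kirchhoffIndex_cycle_le (hG : G.Connected) (hdeg : ∀ v, G.degree v = 2) :
    kirchhoffIndex G ≤ ((Fintype.card V : ℝ) ^ 3 - Fintype.card V) / 12 := by
  have h := Finset.sum_le_sum (s := Finset.univ) fun v _ => kirchhoffAt_cycle_le hG hdeg v
  simp only [Finset.sum_const, Finset.card_univ, nsmul_eq_mul, kirchhoffAt] at h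
  unfold kirchhoffIndex
  linarith

lemma nonempty_iso_triangle (hG : ∀ v, G.degree v = 2) (hcard : Fintype.card V = 3) :
    Nonempty (G ≃g PnD3 3 3) := by
  have hadj : ∀ u v, G.Adj u v ↔ u ≠ v := by
    intro u v
    have hN : G.neighborFinset u = Finset.univ.erase u := by
      refine Finset.eq_of_subset_of_card_le (fun x hx => ?_) ?_
      · rw [SimpleGraph.mem_neighborFinset] at hx
        simp [hx.ne']
      · rw [SimpleGraph.card_neighborFinset_eq_degree, hG, Finset.card_erase_of_mem (by simp),
          Finset.card_univ, hcard]
    rw [← SimpleGraph.mem_neighborFinset, hN]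
    simp [eq_comm]
  have hP : ∀ i j : Fin 3, (PnD3 3 3).Adj i j ↔ i ≠ j := by
    intro i j
    rw [PnD3, SimpleGraph.fromRel_adj]
    fin_cases i <;> fin_cases j <;> simp
  obtain ⟨e⟩ := Fintype.truncEquivFinOfCardEq hcard
  exact ⟨⟨e, fun {a b} => by rw [hP, hadj, e.injective.ne_iff]⟩⟩

end Cycle

section Labelling

/-- The edges of `PnD3`, directed from the smaller to the larger vertex. -/
def PnD3Edge (Δ i j : ℕ) : Prop :=
  i < j ∧ (j ≤ 2 ∨ 3 ≤ j ∧ j ≤ Δ ∧ i = 2 ∨ Δ < j ∧ i + 1 = j)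

lemma PnD3_adj {n Δ : ℕ} (hΔ : 3 ≤ Δ) (i j : Fin n) :
    (PnD3 n Δ).Adj i j ↔ PnD3Edge Δ i j ∨ PnD3Edge Δ j i := by
  have key : ∀ i j : Fin n, ((i.val = 0 ∧ j.val = 1) ∨ (i.val = 0 ∧ j.val = 2) ∨
      (i.val = 1 ∧ j.val = 2) ∨ (i.val = 2 ∧ 3 ≤ j.val ∧ j.val ≤ Δ) ∨
      (Δ ≤ i.val ∧ j.val = i.val + 1)) ↔ PnD3Edge Δ i j := by
    intro i j
    unfold PnD3Edge
    constructor <;> intro h <;> omega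
  rw [PnD3, SimpleGraph.fromRel_adj, key, key]
  refine ⟨fun h => h.2, fun h => ⟨?_, h⟩⟩
  rintro rfl
  unfold PnD3Edge at h
  omega

lemma PnD3Edge_layers_iff {Δ M x y d d' : ℕ} (hΔ : 3 ≤ Δ)
    (hx : (x = 0 ∧ d = M) ∨ (x = 1 ∧ d = M) ∨ (3 ≤ x ∧ x < Δ ∧ d = M) ∨ (x = 2 ∧ d + 1 = M) ∨
      (x + d + 2 = Δ + M ∧ d + 2 ≤ M))
    (hy : (y = 0 ∧ d' = M) ∨ (y = 1 ∧ d' = M) ∨ (3 ≤ y ∧ y < Δ ∧ d' = M) ∨ (y = 2 ∧ d' + 1 = M) ∨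
      (y + d' + 2 = Δ + M ∧ d' + 2 ≤ M)) :
    (d = d' + 1 ∨ d' = d + 1 ∨ (x = 0 ∧ y = 1) ∨ (x = 1 ∧ y = 0)) ↔
      PnD3Edge Δ x y ∨ PnD3Edge Δ y x := by
  unfold PnD3Edge
  rcases hx with hx | hx | hx | hx | hx <;> rcases hy with hy | hy | hy | hy | hy <;> omega

lemma PnD3Edge_shift_iff {Δ i j x y : ℕ} (hΔ : 3 ≤ Δ) (hx : i < 3 ∧ x = i ∨ 3 ≤ i ∧ x = i + 1)
    (hy : j < 3 ∧ y = j ∨ 3 ≤ j ∧ y = j + 1) : PnD3Edge (Δ + 1) x y ↔ PnD3Edge Δ i j := by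
  unfold PnD3Edge
  rcases hx with ⟨hi, rfl⟩ | ⟨hi, rfl⟩ <;> rcases hy with ⟨hj, rfl⟩ | ⟨hj, rfl⟩ <;> omega

lemma PnD3Edge_three_iff {Δ j y : ℕ} (hΔ : 3 ≤ Δ) (hy : j < 3 ∧ y = j ∨ 3 ≤ j ∧ y = j + 1) :
    j = 2 ↔ PnD3Edge (Δ + 1) 3 y ∨ PnD3Edge (Δ + 1) y 3 := by
  unfold PnD3Edge
  rcases hy with ⟨hj, rfl⟩ | ⟨hj, rfl⟩ <;> omega

lemma PnD3_degree_le_two {n Δ : ℕ} (hΔ : 3 ≤ Δ) (i : Fin n) (hi : i.val ≠ 2) :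
    (PnD3 n Δ).degree i ≤ 2 := by
  obtain ⟨a, b, hab⟩ : ∃ a b : ℕ, ∀ j, (PnD3 n Δ).Adj i j → j.val = a ∨ j.val = b := by
    simp_rw [PnD3_adj hΔ, PnD3Edge]
    rcases lt_or_ge i.val 2 with h | h
    · exact ⟨1 - i.val, 2, fun j hj => by omega⟩
    · rcases le_or_gt i.val Δ with h' | h'
      · exact ⟨2, i.val + 1, fun j hj => by omega⟩
      · exact ⟨i.val - 1, i.val + 1, fun j hj => by omega⟩
  rw [SimpleGraph.degree, ← Finset.card_image_of_injective _ Fin.val_injective]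
  refine (Finset.card_le_card (t := {a, b}) fun x hx => ?_).trans Finset.card_le_two
  obtain ⟨j, hj, rfl⟩ := Finset.mem_image.1 hx
  simpa using hab j (by simpa using hj)

variable [Fintype V] {G : SimpleGraph V}

lemma nonempty_iso_of_labelling {n Δ : ℕ} (hcard : Fintype.card V = n) (φ : V → ℕ)
    (hlt : ∀ v, φ v < n) (hinj : Function.Injective φ)
    (hadj : ∀ u v, G.Adj u v ↔ (PnD3 n Δ).Adj ⟨φ u, hlt u⟩ ⟨φ v, hlt v⟩) :
    Nonempty (G ≃g PnD3 n Δ) := by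
  have hbij : Function.Bijective (fun v => (⟨φ v, hlt v⟩ : Fin n)) := by
    rw [Fintype.bijective_iff_injective_and_card]
    exact ⟨fun u v h => hinj (by simpa using h), by simpa using hcard⟩
  exact ⟨⟨Equiv.ofBijective _ hbij, fun {u v} => (hadj u v).symm⟩⟩

/-- A unicyclic graph all of whose distance layers from `p` but the last are singletons. -/
lemma nonempty_iso_of_layers (hG : G.Connected) (hE : G.edgeFinset.card = Fintype.card V) {Δ : ℕ}
    (hΔ : 3 ≤ Δ) (hn : Δ + 1 ≤ Fintype.card V) {p : V} {ρ : ℕ → V}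
    (hle : ∀ v, G.dist p v ≤ Fintype.card V + 1 - Δ)
    (hρ : ∀ j ≤ Fintype.card V + 1 - Δ, G.dist p (ρ j) = j)
    (hlayer : ∀ v, G.dist p v < Fintype.card V + 1 - Δ → v = ρ (G.dist p v)) :
    Nonempty (G ≃g PnD3 (Fintype.card V) Δ) := by
  obtain ⟨par, hpar⟩ := exists_isParent hG p
  obtain ⟨a, b, hab, hba, hext, hall⟩ := hpar.exists_extra_edge hE
  set n := Fintype.card V
  obtain ⟨M, hM⟩ : ∃ M, M = n + 1 - Δ := ⟨_, rfl⟩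
  rw [← hM] at hle hρ hlayer
  set d : V → ℕ := G.dist p
  have hd0 : ∀ v, d v = 0 ↔ v = p := fun v => (hG.dist_eq_zero_iff).trans eq_comm
  have heq : ∀ u v, d u < M → d u = d v → u = v := fun u v hu huv => by
    rw [hlayer u hu, hlayer v (huv ▸ hu), huv]
  have hadj : ∀ u v, G.Adj u v ↔ d u = d v + 1 ∨ d v = d u + 1 ∨ (u = a ∧ v = b) ∨
      (u = b ∧ v = a) := by
    have hup : ∀ u v, d u = d v + 1 → G.Adj u v := by
      intro u v huv
      have hu : u ≠ p := fun h => by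
        have := (hd0 u).2 h
        omega
      have h1 : d (par u) + 1 = d u := hpar.dist u hu
      have h2 := hle u
      rw [heq v (par u) (by omega) (by omega)]
      exact hpar.adj u hu
    intro u v
    constructor
    · intro h
      rcases hall u v h with ⟨hu, rfl⟩ | ⟨hv, rfl⟩ | h
      · exact Or.inl (hpar.dist u hu).symm
      · exact Or.inr (Or.inl (hpar.dist v hv).symm)
      · exact Or.inr (Or.inr (Sym2.eq_iff.1 h))
    · rintro (h | h | ⟨rfl, rfl⟩ | ⟨rfl, rfl⟩)
      · exact hup u v h
      · exact (hup v u h).symm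
      · exact hab
      · exact hab.symm
  have hdab : d a = M ∧ d b = M := by
    have h1 : d a ≤ d b + 1 := dist_le_succ_of_adj hG p hab.symm
    have h2 : d b ≤ d a := hba
    have h3 := hle a
    have h4 : d a ≠ d b + 1 := by
      intro h
      have ha : a ≠ p := fun h' => by
        have := (hd0 a).2 h'
        omega
      have h5 : d (par a) + 1 = d a := hpar.dist a ha
      exact hext a ha (by rw [heq (par a) b (by omega) (by omega)])
    have h5 : ¬ d a < M := fun h => hab.ne (heq a b h (by omega))
    omega
  set L : Finset V := Finset.univ.filter fun v => d v = M ∧ v ≠ a ∧ v ≠ b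
  have hL : L.card + 3 ≤ Δ := by
    have hinj : Set.InjOn ρ (Finset.range M : Finset ℕ) := by
      intro i hi j hj h
      rw [Finset.coe_range, Set.mem_Iio] at hi hj
      have := congrArg d h
      rwa [hρ i hi.le, hρ j hj.le] at this
    have hdisj : Disjoint ((Finset.range M).image ρ) ({a, b} ∪ L) := by
      rw [Finset.disjoint_left]
      intro v hv hv'
      obtain ⟨j, hj, rfl⟩ := Finset.mem_image.1 hv
      rw [Finset.mem_range] at hj
      have hdj : d (ρ j) = j := hρ j hj.le
      simp only [Finset.mem_union, Finset.mem_insert, Finset.mem_singleton, L, Finset.mem_filter,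
        Finset.mem_univ, true_and] at hv'
      rcases hv' with (h | h) | h
      · rw [h] at hdj
        omega
      · rw [h] at hdj
        omega
      · omega
    have hdisj' : Disjoint ({a, b} : Finset V) L := by
      rw [Finset.disjoint_left]
      intro v hv hv'
      simp only [Finset.mem_insert, Finset.mem_singleton, L, Finset.mem_filter] at hv hv'
      tauto
    have := Finset.card_le_univ ((Finset.range M).image ρ ∪ ({a, b} ∪ L))
    rw [Finset.card_union_of_disjoint hdisj, Finset.card_union_of_disjoint hdisj',
      Finset.card_image_of_injOn hinj, Finset.card_range, Finset.card_pair hab.ne] at this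
    omega
  obtain ⟨ψ, hψ, hψinj⟩ : ∃ ψ : V → ℕ, (∀ v ∈ L, ψ v < L.card) ∧ Set.InjOn ψ L := by
    refine ⟨fun v => if h : v ∈ L then L.equivFin ⟨v, h⟩ else 0, fun v hv => ?_, fun u hu v hv h => ?_⟩
    · simp only [hv, dif_pos]
      exact Fin.is_lt _
    · have hu' : u ∈ L := hu
      have hv' : v ∈ L := hv
      simp only [hu', hv', dif_pos] at h
      simpa using L.equivFin.injective (Fin.ext h)
  have hmemL : ∀ v, v ∈ L ↔ d v = M ∧ v ≠ a ∧ v ≠ b := fun v => by simp [L]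
  obtain ⟨φ, hφ⟩ : ∃ φ : V → ℕ, ∀ v, φ v = if v = a then 0 else if v = b then 1 else
      if v ∈ L then ψ v + 3 else if d v + 1 = M then 2 else Δ + M - 2 - d v := ⟨_, fun _ => rfl⟩
  have hcase : ∀ v, (φ v = 0 ∧ v = a ∧ d v = M) ∨ (φ v = 1 ∧ v = b ∧ d v = M) ∨
      (φ v = ψ v + 3 ∧ φ v < Δ ∧ v ∈ L ∧ d v = M) ∨ (φ v = 2 ∧ d v + 1 = M) ∨
      (φ v + d v + 2 = Δ + M ∧ d v + 2 ≤ M) := by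
    intro v
    have hv := hle v
    rw [hφ v]
    split_ifs with h1 h2 h3 h4
    · exact Or.inl ⟨rfl, h1, h1 ▸ hdab.1⟩
    · exact Or.inr (Or.inl ⟨rfl, h2, h2 ▸ hdab.2⟩)
    · have := hψ v h3
      exact Or.inr (Or.inr (Or.inl ⟨rfl, by omega, h3, ((hmemL v).1 h3).1⟩))
    · exact Or.inr (Or.inr (Or.inr (Or.inl ⟨rfl, h4⟩)))
    · have h5 : d v ≠ M := fun h => h3 ((hmemL v).2 ⟨h, h1, h2⟩)
      exact Or.inr (Or.inr (Or.inr (Or.inr ⟨by omega, by omega⟩)))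
  have ha : ∀ v, v = a ↔ φ v = 0 := fun v =>
    ⟨fun h => by rw [hφ, if_pos h], fun h => by rcases hcase v with h' | h' | h' | h' | h' <;>
      first | exact h'.2.1 | omega⟩
  have hb : ∀ v, v = b ↔ φ v = 1 := fun v =>
    ⟨fun h => by rw [hφ, if_neg (by rw [h]; exact hab.ne'), if_pos h],
      fun h => by rcases hcase v with h' | h' | h' | h' | h' <;>
        first | omega | exact h'.2.1⟩
  refine nonempty_iso_of_labelling rfl φ (fun v => ?_) (fun u v huv => ?_) fun u v => ?_
  · rcases hcase v with h | h | h | h | h <;> omega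
  · rcases hcase u with h | h | h | h | h
    · rw [h.2.1, (ha v).2 (by omega)]
    · rw [h.2.1, (hb v).2 (by omega)]
    · rcases hcase v with h' | h' | h' | h' | h'
      · omega
      · omega
      · exact hψinj h.2.2.1 h'.2.2.1 (by omega)
      · omega
      · omega
    · exact heq u v (by omega) (by rcases hcase v with h' | h' | h' | h' | h' <;> omega)
    · exact heq u v (by omega) (by rcases hcase v with h' | h' | h' | h' | h' <;> omega)
  · rw [hadj, PnD3_adj hΔ]
    simp only [ha, hb]
    refine PnD3Edge_layers_iff hΔ (M := M) ?_ ?_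
    · rcases hcase u with h | h | h | h | h <;> omega
    · rcases hcase v with h | h | h | h | h <;> omega

/-- Attaching a pendant vertex to the vertex of large degree of `PnD3`. -/
lemma IsPendantExt.nonempty_iso [Fintype W] {G' : SimpleGraph W} {ι : W → V} {p : V} {q : W}
    (h : IsPendantExt G' G ι p q) {Δ : ℕ} (hΔ : 3 ≤ Δ)
    (hq : Δ ≤ G'.degree q) (e : G' ≃g PnD3 (Fintype.card W) Δ) :
    Nonempty (G ≃g PnD3 (Fintype.card V) (Δ + 1)) := by
  have he : (e q).val = 2 := by
    by_contra hne
    have h1 := PnD3_degree_le_two hΔ (e q) hne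
    rw [e.degree_eq] at h1
    omega
  obtain ⟨φ, hφp, hφ⟩ : ∃ φ : V → ℕ, φ p = 3 ∧
      ∀ a, φ (ι a) = if (e a).val < 3 then (e a).val else (e a).val + 1 := by
    refine ⟨Function.extend ι (fun a => if (e a).val < 3 then (e a).val else (e a).val + 1)
      fun _ => 3, ?_, fun a => h.inj.extend_apply _ _ a⟩
    rw [Function.extend_apply']
    rintro ⟨a, ha⟩
    exact h.ne a ha
  have hcard := h.card_eq
  refine nonempty_iso_of_labelling rfl φ (fun v => ?_) (fun u v huv => ?_) fun u v => ?_
  · by_cases hv : v = p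
    · rw [hv]
      omega
    · obtain ⟨a, rfl⟩ := h.surj v hv
      have := (e a).is_lt
      rw [hφ]
      split_ifs <;> omega
  · by_cases hu : u = p <;> by_cases hv : v = p
    · rw [hu, hv]
    · obtain ⟨a, rfl⟩ := h.surj v hv
      rw [hu, hφp, hφ] at huv
      split_ifs at huv <;> omega
    · obtain ⟨a, rfl⟩ := h.surj u hu
      rw [hv, hφp, hφ] at huv
      split_ifs at huv <;> omega
    · obtain ⟨a, rfl⟩ := h.surj u hu
      obtain ⟨b, rfl⟩ := h.surj v hv
      rw [hφ, hφ] at huv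
      have : (e a).val = (e b).val := by split_ifs at huv <;> omega
      rw [e.injective (Fin.ext this)]
  · have hpend : ∀ a, G.Adj p (ι a) ↔ (e a).val = 2 := by
      intro a
      rw [h.adj_pendant, h.inj.eq_iff]
      refine ⟨fun h' => h' ▸ he, fun h' => e.injective (Fin.ext (h'.trans he.symm))⟩
    have hφ' : ∀ a, (e a).val < 3 ∧ φ (ι a) = (e a).val ∨ 3 ≤ (e a).val ∧
        φ (ι a) = (e a).val + 1 := by
      intro a
      rw [hφ]
      split_ifs <;> omega
    rw [PnD3_adj (by omega)]
    by_cases hu : u = p <;> by_cases hv : v = p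
    · rw [hu, hv]
      simp [PnD3Edge]
    · obtain ⟨a, rfl⟩ := h.surj v hv
      simp only [hu, hφp, hpend]
      exact PnD3Edge_three_iff hΔ (hφ' a)
    · obtain ⟨a, rfl⟩ := h.surj u hu
      rw [G.adj_comm, or_comm]
      simp only [hv, hφp, hpend]
      exact PnD3Edge_three_iff hΔ (hφ' a)
    · obtain ⟨a, rfl⟩ := h.surj u hu
      obtain ⟨b, rfl⟩ := h.surj v hv
      rw [h.adj_iff, ← e.map_adj_iff, PnD3_adj hΔ, PnD3Edge_shift_iff hΔ (hφ' a) (hφ' b),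
        PnD3Edge_shift_iff hΔ (hφ' b) (hφ' a)]

end Labelling

section UpperBound

/-- The Kirchhoff index of `PnD3 n Δ`. -/
def maxKirchhoff (n Δ : ℝ) : ℝ :=
  (n - Δ + 1) * (n - Δ + 2) * (n + 2 * Δ - 9) / 6 + (Δ - 3) * (Δ - 2 / 3) + (n - Δ) ^ 2
    + 7 * (n - Δ) / 3 + 2

variable [Fintype V] {G : SimpleGraph V}

lemma degree_pos_of_unicyclic (hG : G.Connected) (hE : G.edgeFinset.card = Fintype.card V)
    (v : V) : 0 < G.degree v := by
  have hpos : 0 < G.edgeFinset.card := by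
    rw [hE]
    exact Fintype.card_pos_iff.2 ⟨v⟩
  obtain ⟨e, he⟩ := Finset.card_pos.1 hpos
  induction e using Sym2.ind with
  | _ a b =>
    have : Nontrivial V := ⟨a, b, (SimpleGraph.mem_edgeFinset.1 he).ne⟩
    exact hG.preconnected.degree_pos_of_nontrivial v

lemma degree_eq_two_of_unicyclic (hE : G.edgeFinset.card = Fintype.card V)
    (h : (∀ v, 2 ≤ G.degree v) ∨ ∀ v, G.degree v ≤ 2) (v : V) : G.degree v = 2 := by
  have hsum : ∑ v, G.degree v = ∑ _v : V, 2 := by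
    rw [G.sum_degrees_eq_twice_card_edges, hE]
    simp [mul_comm]
  rcases h with h | h
  · exact ((Finset.sum_eq_sum_iff_of_le fun i _ => h i).1 hsum.symm v (Finset.mem_univ v)).symm
  · exact (Finset.sum_eq_sum_iff_of_le fun i _ => h i).1 hsum v (Finset.mem_univ v)

lemma kirchhoffIndex_le_of_cycle (hG : G.Connected) (hdeg : ∀ v, G.degree v = 2) :
    kirchhoffIndex G ≤ maxKirchhoff (Fintype.card V) (3 : ℕ) ∧
      (kirchhoffIndex G = maxKirchhoff (Fintype.card V) (3 : ℕ) →
        Nonempty (G ≃g PnD3 (Fintype.card V) 3)) := by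
  have h := kirchhoffIndex_cycle_le hG hdeg
  obtain ⟨v⟩ := hG.nonempty
  have h3 := (exists_cyclic_enumeration hG hdeg v).1
  have h3' : (3 : ℝ) ≤ Fintype.card V := by exact_mod_cast h3
  have hg : maxKirchhoff (Fintype.card V) (3 : ℕ)
      = ((Fintype.card V : ℝ) ^ 3 - Fintype.card V) / 12
        + ((Fintype.card V : ℝ) - 3) * ((Fintype.card V : ℝ) ^ 2 + 3 * Fintype.card V - 12) / 12 := by
    unfold maxKirchhoff
    push_cast
    ring
  have hpos : 0 < (Fintype.card V : ℝ) ^ 2 + 3 * Fintype.card V - 12 := by nlinarith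
  have hprod := mul_nonneg (sub_nonneg.2 h3') hpos.le
  rw [hg]
  refine ⟨by linarith, fun heq => ?_⟩
  have h0 : ((Fintype.card V : ℝ) - 3) * ((Fintype.card V : ℝ) ^ 2 + 3 * Fintype.card V - 12) = 0 := by
    linarith
  rcases mul_eq_zero.1 h0 with h0 | h0
  · have hc : Fintype.card V = 3 := by exact_mod_cast sub_eq_zero.1 h0
    have := nonempty_iso_triangle hdeg hc
    rwa [← hc] at this ⊢
  · linarith

/-- The upper bound for the Kirchhoff index and the uniqueness of the maximizer. -/
theorem kirchhoffIndex_le_maxKirchhoff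
    (hG : G.Connected) (hE : G.edgeFinset.card = Fintype.card V) {Δ : ℕ} (hΔ : 3 ≤ Δ)
    (hdeg : Δ = 3 ∨ ∃ w, Δ ≤ G.degree w) :
    kirchhoffIndex G ≤ maxKirchhoff (Fintype.card V) Δ ∧
      (kirchhoffIndex G = maxKirchhoff (Fintype.card V) Δ →
        Nonempty (G ≃g PnD3 (Fintype.card V) Δ)) := by
  induction hk : Fintype.card V using Nat.strong_induction_on generalizing V Δ with
  | _ k ih =>
  subst hk
  by_cases hpend : ∀ v, G.degree v ≠ 1
  · have hdeg2 := degree_eq_two_of_unicyclic hE (Or.inl fun v => by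
      have := degree_pos_of_unicyclic hG hE v
      have := hpend v
      omega)
    obtain rfl : Δ = 3 := by
      rcases hdeg with h | ⟨w, hw⟩
      · exact h
      · rw [hdeg2] at hw
        omega
    exact kirchhoffIndex_le_of_cycle hG hdeg2
  push Not at hpend
  obtain ⟨p, hp⟩ := hpend
  obtain ⟨x, hx⟩ : ∃ x, ∀ y, G.Adj p y ↔ y = x := by
    obtain ⟨x, hx, hx'⟩ := SimpleGraph.degree_eq_one_iff_existsUnique_adj.1 hp
    exact ⟨x, fun y => ⟨hx' y, fun h => h ▸ hx⟩⟩
  obtain ⟨w, hw⟩ : ∃ w, Δ ≤ G.degree w := by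
    rcases hdeg with rfl | h
    · by_contra! h
      have := degree_eq_two_of_unicyclic hE (Or.inr fun v => by have := h v; omega) p
      omega
    · exact h
  have hn : Δ + 1 ≤ Fintype.card V := by
    have := G.degree_lt_card_verts w
    omega
  obtain ⟨q, hext⟩ := isPendantExt_induce hx
  have hG' := hG.induce_compl_singleton_of_degree_eq_one hp
  generalize G.induce ({p}ᶜ : Set V) = G' at hext hG'
  have hcard := hext.card_eq
  have hE' : G'.edgeFinset.card = Fintype.card ↥({p}ᶜ : Set V) := by
    have := hext.card_edges
    omega
  have hKf := hext.kirchhoffIndex_eq hG'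
  have hat := kirchhoffAt_le hG hE p
  have hcardR : (Fintype.card V : ℝ) = Fintype.card ↥({p}ᶜ : Set V) + 1 := by exact_mod_cast hcard
  by_cases hA : Δ = 3 ∨ ∃ a, Δ ≤ G'.degree a
  · obtain ⟨hle, -⟩ := ih _ (by omega) hG' hE' hΔ hA rfl
    obtain ⟨hW, hWeq⟩ := wienerAt_le hG p hΔ hw
    have hstep : maxKirchhoff (Fintype.card V) Δ = maxKirchhoff (Fintype.card ↥({p}ᶜ : Set V)) Δ +
        ((Fintype.card V : ℝ) * (((Fintype.card V : ℝ) - Δ) + 1) -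
          (((Fintype.card V : ℝ) - Δ) + 1) * (((Fintype.card V : ℝ) - Δ) + 2) / 2) - 2 / 3 := by
      rw [hcardR]
      unfold maxKirchhoff
      ring
    refine ⟨by linarith, fun heq => ?_⟩
    obtain ⟨ρ, h1, h2, h3⟩ := hWeq (by linarith)
    exact nonempty_iso_of_layers hG hE hΔ hn h1 h2 h3
  · push Not at hA
    obtain ⟨D, rfl⟩ : ∃ D, Δ = D + 1 := ⟨Δ - 1, by omega⟩
    have hwp : w ≠ p := by
      rintro rfl
      omega
    obtain ⟨a, rfl⟩ := hext.surj w hwp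
    have hda := hext.degree_eq a
    have hlt := hA.2 a
    obtain rfl : a = q := by
      by_contra hne
      rw [if_neg hne] at hda
      omega
    rw [if_pos rfl] at hda
    have hDq : D ≤ G'.degree a := by omega
    have hD : 3 ≤ D := by
      have := hA.1
      omega
    obtain ⟨hle, heq'⟩ := ih _ (by omega) hG' hE' hD (Or.inr ⟨a, hDq⟩) rfl
    have hW := wienerAt_pendant_le hG hΔ hw hext.adj_pendant
    have hstep : maxKirchhoff (Fintype.card V) (D + 1 : ℕ) =
        maxKirchhoff (Fintype.card ↥({p}ᶜ : Set V)) D +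
        ((Fintype.card V : ℝ) * (((Fintype.card V : ℝ) - (D + 1 : ℕ)) + 1) -
          (((Fintype.card V : ℝ) - (D + 1 : ℕ)) + 1) - ((Fintype.card V : ℝ) - (D + 1 : ℕ)) -
          (((D + 1 : ℕ) : ℝ) - 1) * (((Fintype.card V : ℝ) - (D + 1 : ℕ)) - 1) -
          (((Fintype.card V : ℝ) - (D + 1 : ℕ)) - 1) *
            (((Fintype.card V : ℝ) - (D + 1 : ℕ)) - 2) / 2) - 2 / 3 := by
      rw [hcardR]
      unfold maxKirchhoff
      push_cast
      ring
    refine ⟨by linarith, fun heq => ?_⟩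
    obtain ⟨e⟩ := heq' (by linarith)
    exact hext.nonempty_iso hD hDq e

end UpperBound

section Extremal

lemma PnD3_three_eq_top {Δ : ℕ} (hΔ : 3 ≤ Δ) : PnD3 3 Δ = ⊤ := by
  ext i j
  rw [PnD3_adj hΔ, SimpleGraph.top_adj, ne_eq, Fin.ext_iff]
  unfold PnD3Edge
  omega

lemma two_thirds_le_resistanceDistance_top {u v : Fin 3} (huv : u ≠ v) :
    2 / 3 ≤ resistanceDistance (⊤ : SimpleGraph (Fin 3)) u v := by
  have h := sq_le_resistanceDistance_mul_energy
    (SimpleGraph.connected_top.preconnected u v : (⊤ : SimpleGraph (Fin 3)).Reachable u v)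
    (fun x => if x = u then 1 else if x = v then 0 else 1 / 2)
  have hE : energy (⊤ : SimpleGraph (Fin 3))
      (fun x => if x = u then 1 else if x = v then 0 else 1 / 2) = 3 / 2 := by
    unfold energy
    fin_cases u <;> fin_cases v <;> simp [Fin.sum_univ_three] at huv ⊢ <;> norm_num
  rw [hE] at h
  simp only [if_true, huv.symm, if_false] at h
  linarith

lemma isPendantExt_PnD3 {n Δ : ℕ} (hΔ : 3 ≤ Δ) (hn : 3 ≤ n) (q : Fin n)
    (hq : n ≤ Δ ∧ q.val = 2 ∨ Δ < n ∧ q.val + 1 = n) :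
    IsPendantExt (PnD3 n Δ) (PnD3 (n + 1) Δ) Fin.castSucc (Fin.last n) q where
  inj := Fin.castSucc_injective n
  ne a := (Fin.castSucc_lt_last a).ne
  surj v hv := Fin.exists_castSucc_eq.2 hv
  adj_iff a b := by simp [PnD3_adj hΔ]
  adj_pendant x := by
    rw [PnD3_adj hΔ, Fin.ext_iff, Fin.val_castSucc, Fin.val_last]
    have := x.is_lt
    unfold PnD3Edge
    omega

lemma IsPendantExt.one_add_kirchhoffAt_le [Fintype V] [Fintype W] {G' : SimpleGraph W}
    {G : SimpleGraph V} {ι : W → V} {p : V} {q : W} (h : IsPendantExt G' G ι p q)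
    (hG' : G'.Connected) : 1 + kirchhoffAt G' q ≤ kirchhoffAt G (ι q) := by
  have h1 := h.one_add_resistanceDistance_le hG' q
  rw [resistanceDistance_self, resistanceDistance_comm (h.connected hG')] at h1
  unfold kirchhoffAt
  simp_rw [h.sum_eq, h.resistanceDistance_eq hG']
  linarith

/-- The resistances of a triangle with pendant vertices attached to one of its vertices. -/
lemma le_kirchhoffIndex_star {Δ : ℕ} (hΔ : 3 ≤ Δ) (k : ℕ) (hk : k + 3 ≤ Δ) :
    (PnD3 (k + 3) Δ).Connected ∧
      (k : ℝ) + 4 / 3 ≤ kirchhoffAt (PnD3 (k + 3) Δ) ⟨2, by omega⟩ ∧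
      ((k : ℝ) + 3) ^ 2 - 8 * ((k : ℝ) + 3) / 3 + 1 ≤ kirchhoffIndex (PnD3 (k + 3) Δ) := by
  induction k with
  | zero =>
    change (PnD3 3 Δ).Connected ∧ ((0 : ℕ) : ℝ) + 4 / 3 ≤ kirchhoffAt (PnD3 3 Δ) 2 ∧
      (((0 : ℕ) : ℝ) + 3) ^ 2 - 8 * (((0 : ℕ) : ℝ) + 3) / 3 + 1 ≤ kirchhoffIndex (PnD3 3 Δ)
    rw [PnD3_three_eq_top hΔ]
    have h01 := two_thirds_le_resistanceDistance_top (show (0 : Fin 3) ≠ 1 by decide)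
    have h02 := two_thirds_le_resistanceDistance_top (show (0 : Fin 3) ≠ 2 by decide)
    have h10 := two_thirds_le_resistanceDistance_top (show (1 : Fin 3) ≠ 0 by decide)
    have h12 := two_thirds_le_resistanceDistance_top (show (1 : Fin 3) ≠ 2 by decide)
    have h20 := two_thirds_le_resistanceDistance_top (show (2 : Fin 3) ≠ 0 by decide)
    have h21 := two_thirds_le_resistanceDistance_top (show (2 : Fin 3) ≠ 1 by decide)
    refine ⟨SimpleGraph.connected_top, ?_, ?_⟩
    · rw [kirchhoffAt, Fin.sum_univ_three, resistanceDistance_self]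
      push_cast
      linarith
    · rw [kirchhoffIndex]
      simp only [Fin.sum_univ_three, resistanceDistance_self]
      push_cast
      linarith
  | succ k ih =>
    obtain ⟨hconn, hat, hKf⟩ := ih (by omega)
    have hext := isPendantExt_PnD3 hΔ (by omega) (⟨2, by omega⟩ : Fin (k + 3))
      (Or.inl ⟨by omega, rfl⟩)
    have h1 := hext.card_add_kirchhoffAt_le hconn
    have h2 := hext.one_add_kirchhoffAt_le hconn
    have h3 := hext.kirchhoffIndex_eq hconn
    rw [Fintype.card_fin] at h1
    refine ⟨hext.connected hconn, ?_, ?_⟩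
    · change _ ≤ kirchhoffAt (PnD3 (k + 3 + 1) Δ) (Fin.castSucc ⟨2, by omega⟩)
      push_cast
      linarith
    · change _ ≤ kirchhoffIndex (PnD3 (k + 3 + 1) Δ)
      push_cast at h1 ⊢
      nlinarith

theorem maxKirchhoff_le_kirchhoffIndex_PnD3 {Δ : ℕ} (hΔ : 3 ≤ Δ) (k : ℕ) :
    (PnD3 (Δ + k + 1) Δ).Connected ∧
      ((Δ : ℝ) + k + 1) * (k + 2) - (k + 2) * (k + 3) / 2 - 2 / 3
        ≤ kirchhoffAt (PnD3 (Δ + k + 1) Δ) (Fin.last _) ∧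
      maxKirchhoff (Δ + k + 1 : ℕ) Δ ≤ kirchhoffIndex (PnD3 (Δ + k + 1) Δ) := by
  induction k with
  | zero =>
    obtain ⟨m, rfl⟩ := Nat.exists_eq_add_of_le' hΔ
    obtain ⟨hconn, hat, hKf⟩ := le_kirchhoffIndex_star hΔ m le_rfl
    have hext := isPendantExt_PnD3 hΔ hΔ (⟨2, by omega⟩ : Fin (m + 3)) (Or.inl ⟨le_rfl, rfl⟩)
    have h1 := hext.card_add_kirchhoffAt_le hconn
    have h3 := hext.kirchhoffIndex_eq hconn
    rw [Fintype.card_fin] at h1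
    rw [add_zero]
    refine ⟨hext.connected hconn, ?_, ?_⟩
    · push_cast at h1 ⊢
      linarith
    · unfold maxKirchhoff
      push_cast at h1 ⊢
      nlinarith
  | succ k ih =>
    obtain ⟨hconn, hat, hKf⟩ := ih
    have hext := isPendantExt_PnD3 hΔ (by omega) (Fin.last (Δ + k)) (Or.inr ⟨by omega, rfl⟩)
    have h1 := hext.card_add_kirchhoffAt_le hconn
    have h3 := hext.kirchhoffIndex_eq hconn
    rw [Fintype.card_fin] at h1
    rw [← add_assoc Δ k 1]
    have hstep : maxKirchhoff (Δ + k + 1 + 1 : ℕ) Δ = maxKirchhoff (Δ + k + 1 : ℕ) Δ +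
        (((Δ : ℝ) + (k + 1 : ℕ) + 1) * ((k + 1 : ℕ) + 2) -
          ((k + 1 : ℕ) + 2) * ((k + 1 : ℕ) + 3) / 2 - 2 / 3) := by
      unfold maxKirchhoff
      push_cast
      ring
    have hat' : ((Δ : ℝ) + (k + 1 : ℕ) + 1) * ((k + 1 : ℕ) + 2) -
        ((k + 1 : ℕ) + 2) * ((k + 1 : ℕ) + 3) / 2 - 2 / 3
        ≤ kirchhoffAt (PnD3 (Δ + k + 1 + 1) Δ) (Fin.last _) := by
      push_cast at h1 ⊢
      linarith
    exact ⟨hext.connected hconn, hat', by linarith⟩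

end Extremal

/-- Maximizing the Kirchhoff index of unicyclic graphs with fixed order `n`, cycle length
`l ≥ 3` and maximum degree `Δ ≥ 3`, for `n ≥ l + Δ − 2`; the maximum is attained exactly
at `P_{n,Δ}^3`. -/
theorem statement0 [Fintype V] (G : SimpleGraph V) (n l Δ : ℕ)
    (hcard : Fintype.card V = n)
    (huni : IsUnicyclic G)
    (hcyc : ∃ (u : V) (c : G.Walk u u), c.IsCycle ∧ c.length = l)
    (hmax : HasMaxDegree G Δ)
    (hl : 3 ≤ l) (hΔ : 3 ≤ Δ) (hn : l + Δ - 2 ≤ n) :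
    kirchhoffIndex G ≤
      ((n : ℝ) - Δ + 1) * ((n : ℝ) - Δ + 2) * ((n : ℝ) + 2 * Δ - 9) / 6
        + ((Δ : ℝ) - 3) * ((Δ : ℝ) - 2 / 3) + ((n : ℝ) - Δ) ^ 2 + 7 * ((n : ℝ) - Δ) / 3 + 2
    ∧ (kirchhoffIndex G =
        ((n : ℝ) - Δ + 1) * ((n : ℝ) - Δ + 2) * ((n : ℝ) + 2 * Δ - 9) / 6
          + ((Δ : ℝ) - 3) * ((Δ : ℝ) - 2 / 3) + ((n : ℝ) - Δ) ^ 2 + 7 * ((n : ℝ) - Δ) / 3 + 2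
        ↔ Nonempty (G ≃g PnD3 n Δ)) := by
  obtain ⟨w, hw⟩ := hmax.2
  have hE : G.edgeFinset.card = Fintype.card V := by
    rw [SimpleGraph.edgeFinset_card, ← Nat.card_eq_fintype_card, huni.2]
  have hdeg : Δ ≤ G.degree w := by
    rw [← SimpleGraph.card_neighborSet_eq_degree, ← Nat.card_eq_fintype_card]
    exact hw.ge
  obtain ⟨hle, hiso⟩ := kirchhoffIndex_le_maxKirchhoff huni.1 hE hΔ (Or.inr ⟨w, hdeg⟩)
  subst hcard
  refine ⟨hle, hiso, fun ⟨e⟩ => le_antisymm hle ?_⟩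
  obtain ⟨k, hk⟩ := Nat.exists_eq_add_of_le (show Δ + 1 ≤ Fintype.card V by omega)
  replace hk : Fintype.card V = Δ + k + 1 := by omega
  have h := (maxKirchhoff_le_kirchhoffIndex_PnD3 hΔ k).2.2
  rw [← hk] at h
  exact h.trans (kirchhoffIndex_le_of_iso huni.1 e)

end KfPaper
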